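/- (Second variant of the Andrews–Gordon identities) For all integers ν ≥ 1, 0 ≤ s ≤ ν, M ≥ 1, and all complex q with 0 < |q| < 1: Σ over tuples n = (n_1,…,n_ν) of nonnegative integers of q^{N_1²+⋯+N_ν²+N_{s+1}+⋯+N_ν−M(N_1+⋯+N_ν)} / ((q)_{n_1}(q)_{n_2}⋯(q)_{n_ν}) = Σ over integers s' with 1 ≤ s' ≤ 2ν+2 and s + s' ≢ νM (mod 2) of W^ν_{s',ν−s}(M,1/q) / ∏_{j ≥ 1, j ≢ 0, ±s' (mod 2ν+3)} (1−q^j). -/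

import Mathlib

open scoped Classical

noncomputable section

/-- The q-Pochhammer symbol `(q)_n = ∏_{j=1}^n (1 - q^j)`. -/
def qP {F : Type*} [Field F] (q : F) (n : ℕ) : F :=
  ∏ j ∈ Finset.range n, (1 - q ^ (j + 1))

/-- The q-binomial coefficient `[N choose k]_q = (q)_N / ((q)_k (q)_{N-k})`
for `0 ≤ k ≤ N`, and `0` otherwise. -/
def qB {F : Type*} [Field F] (q : F) (N k : ℤ) : F :=
  if 0 ≤ k ∧ k ≤ N then qP q N.toNat / (qP q k.toNat * qP q (N - k).toNat) else 0

/-- `NN n i = N_i = n_i + n_{i+1} + ⋯ + n_ν` (indices 1-based; `n ⟨k⟩` is `n_{k+1}`). -/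
def NN {ν : ℕ} (n : Fin ν → ℕ) (i : ℕ) : ℕ :=
  ∑ k : Fin ν, if i ≤ (k : ℕ) + 1 then n k else 0

/-- `α_{i,s} = max(0, i - s)`. -/
def alph (i s : ℕ) : ℤ := max 0 ((i : ℤ) - s)

/-- The exponent `N_1² + ⋯ + N_ν² + N_{s+1} + ⋯ + N_ν`. -/
def expAG (ν s : ℕ) (nn : Fin ν → ℕ) : ℕ :=
  (∑ i ∈ Finset.Icc 1 ν, (NN nn i) ^ 2) + ∑ i ∈ Finset.Icc (s + 1) ν, NN nn i

/-- The polynomial `B^ν_{s,b}(L,q)` of Foda–Quano–Kirillov type. -/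
def B {F : Type*} [Field F] (ν : ℕ) (s b : ℤ) (L : ℕ) (q : F) : F :=
  ∑ᶠ j : ℤ,
    (q ^ (j * ((2 * j + 1) * (2 * (ν : ℤ) + 3) - 2 * s)) *
        qB q (L : ℤ) (((L : ℤ) + b - s) / 2 + j * (2 * (ν : ℤ) + 3)) -
      q ^ ((2 * j + 1) * ((2 * (ν : ℤ) + 3) * j + s)) *
        qB q (L : ℤ) (((L : ℤ) + b + s) / 2 + j * (2 * (ν : ℤ) + 3)))

/-- `jjf j l = j_l` for `1 ≤ l ≤ ν` (and junk value `0` otherwise). -/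
def jjf {ν : ℕ} (j : Fin ν → ℕ) (l : ℕ) : ℤ :=
  if h : l - 1 < ν then (j ⟨l - 1, h⟩ : ℤ) else 0

/-- The q-multinomial coefficient `[L choose a]^(p)_ν`. -/
def qMulti {F : Type*} [Field F] (ν L : ℕ) (a : ℤ) (p : ℕ) (q : F) : F :=
  ∑ᶠ j : Fin ν → ℕ,
    if (∑ l, (j l : ℤ)) = a then
      q ^ ((∑ l ∈ Finset.Icc 2 ν, jjf j (l - 1) * ((L : ℤ) - jjf j l)) -
            ∑ l ∈ Finset.Icc 1 p, jjf j l) *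
        qB q (L : ℤ) (jjf j ν) * ∏ l ∈ Finset.Icc 2 ν, qB q (jjf j l) (jjf j (l - 1))
    else 0

/-- The polynomial `W^ν_{s,b}(L,q)` of Warnaar type. -/
def W {F : Type*} [Field F] (ν : ℕ) (s : ℤ) (b L : ℕ) (q : F) : F :=
  ∑ᶠ j : ℤ,
    (q ^ (j * ((2 * j + 1) * (2 * (ν : ℤ) + 3) - 2 * s)) *
        qMulti ν L (((ν : ℤ) * ((L : ℤ) + 1) - s - b + 1) / 2 + (2 * (ν : ℤ) + 3) * j) b q -
      q ^ ((2 * j + 1) * ((2 * (ν : ℤ) + 3) * j + s)) *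
        qMulti ν L (((ν : ℤ) * ((L : ℤ) + 1) + s - b + 1) / 2 + (2 * (ν : ℤ) + 3) * j) b q)

/-! ### Bressoud lattice paths -/

/-- Step values: `0 ↦ NE (+1)`, `1 ↦ SE (−1)`, `2 ↦ horizontal (0)`. -/
def stepVal : Fin 3 → ℤ := ![1, -1, 0]

/-- Height of the path after `k` steps, starting at height `s`. -/
def hts (s : ℤ) {n : ℕ} (d : Fin n → Fin 3) (k : ℕ) : ℤ :=
  s + ∑ i ∈ Finset.range k, if h : i < n then stepVal (d ⟨i, h⟩) else 0

/-- The vertex `k` is a peak: it is preceded by a NE step and followed by a SE step. -/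
def IsPeak {n : ℕ} (d : Fin n → Fin 3) (k : ℕ) : Prop :=
  ∃ hk : k < n, 1 ≤ k ∧ d ⟨k - 1, Nat.lt_of_le_of_lt (Nat.sub_le k 1) hk⟩ = 0 ∧ d ⟨k, hk⟩ = 1

/-- `d` encodes a Bressoud path from height `s` to height `b` whose peaks have height `≤ ν`:
SE steps only from positive height, horizontal steps only on the x-axis. -/
def ValidPath (ν : ℕ) (s b : ℤ) {n : ℕ} (d : Fin n → Fin 3) : Prop :=
  hts s d n = b ∧
    (∀ k : Fin n, (d k = 1 → 0 < hts s d (k : ℕ)) ∧ (d k = 2 → hts s d (k : ℕ) = 0)) ∧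
    (∀ k : ℕ, IsPeak d k → hts s d k ≤ (ν : ℤ))

/-- The weight of a Bressoud path starting at x-coordinate `M`:
the sum of the x-coordinates of its peaks. -/
def pwt (M : ℤ) {n : ℕ} (d : Fin n → Fin 3) : ℤ :=
  ∑ k ∈ Finset.range (n + 1), if IsPeak d k then M + (k : ℤ) else 0

/-- `C^ν_{M,L}(s,b,q)`: the weighted count of Bressoud paths from `(M,s)` to `(L,b)`
with no peak higher than `ν`. -/
def Cpoly {F : Type*} [Field F] (ν : ℕ) (M L : ℤ) (s b : ℕ) (q : F) : F :=
  ∑ d ∈ Finset.univ.filter (fun d : Fin (L - M).toNat → Fin 3 => ValidPath ν (s : ℤ) (b : ℤ) d),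
    q ^ pwt M d

/-- `t` is an admissible relative height for the peak at vertex `k`. -/
def RelProp (s : ℤ) {n : ℕ} (d : Fin n → Fin 3) (k t : ℕ) : Prop :=
  0 < t ∧ ∃ k' k'' : ℕ, k' < k ∧ k < k'' ∧ k'' ≤ n ∧
    hts s d k' = hts s d k - t ∧ hts s d k'' = hts s d k - t ∧
    ∀ m : ℕ, k' < m → m < k'' → IsPeak d m →
      hts s d m ≤ hts s d k ∧ (hts s d m = hts s d k → k ≤ m)

/-- The relative height of the peak at vertex `k`: the largest `t` with `RelProp`. -/
def relHt (ν : ℕ) (s : ℤ) {n : ℕ} (d : Fin n → Fin 3) (k : ℕ) : ℕ :=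
  Nat.findGreatest (RelProp s d k) (ν + n)

/-- `P^ν_{M,L}(s,b,n)`: Bressoud paths from `(M,s)` to `(L,b)`, peaks of height at most `ν`,
with exactly `nn j` peaks of relative height `j+1`. -/
def Pset (ν : ℕ) (M L : ℤ) (s b : ℤ) (nn : Fin ν → ℕ) : Finset (Fin (L - M).toNat → Fin 3) :=
  Finset.univ.filter (fun d => ValidPath ν s b d ∧
    ∀ j : Fin ν, ((Finset.range ((L - M).toNat + 1)).filter
      (fun k => IsPeak d k ∧ relHt ν s d k = (j : ℕ) + 1)).card = nn j)

/-! ### Gordon lattice paths -/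

/-- `f` encodes a Gordon path of length `n` from height `s` to height `b`:
`f 0 = s`, `f n = b`, adjacent frequencies sum to at most `ν`; values beyond `n` are `0`. -/
def IsGordon (ν n s b : ℕ) (f : ℕ → ℕ) : Prop :=
  f 0 = s ∧ f n = b ∧ (∀ k, k < n → f k + f (k + 1) ≤ ν) ∧ (∀ k, n < k → f k = 0)

/-- The weight `Σ_{j=M+1}^{L-1} j f_j` of a Gordon path starting at x-coordinate `M`. -/
def gwt (M : ℤ) (n : ℕ) (f : ℕ → ℕ) : ℤ :=
  ∑ k ∈ Finset.Ioo 0 n, (M + (k : ℤ)) * (f k : ℤ)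

/-- `G^ν_{M,L}(s,b,q)`: the weighted count of Gordon paths from `(M,s)` to `(L,b)`. -/
def G {F : Type*} [Field F] (ν : ℕ) (M L : ℤ) (s b : ℕ) (q : F) : F :=
  ∑ᶠ f : ℕ → ℕ, if IsGordon ν (L - M).toNat s b f then q ^ gwt M (L - M).toNat f else 0

/-- `F^ν_{s,b}(L,q)` of (2.21). -/
def Fpoly {F : Type*} [Field F] (ν s b L : ℕ) (q : F) : F :=
  ∑ᶠ nn : Fin ν → ℕ, q ^ expAG ν s nn *
    ∏ i : Fin ν, qB q ((nn i : ℤ) + ((i : ℕ) + 1) * (L : ℤ) -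
      2 * (∑ l ∈ Finset.Icc 1 ((i : ℕ) + 1), (NN nn l : ℤ)) -
      alph ((i : ℕ) + 1) s - alph ((i : ℕ) + 1) b) (nn i)

/-- The left-hand side of (4.2): `F` with the extra `−M(N_1+⋯+N_ν)` in the exponent. -/
def FpolyM {F : Type*} [Field F] (ν s b L M : ℕ) (q : F) : F :=
  ∑ᶠ nn : Fin ν → ℕ,
    q ^ ((expAG ν s nn : ℤ) - (M : ℤ) * ∑ i ∈ Finset.Icc 1 ν, (NN nn i : ℤ)) *
    ∏ i : Fin ν, qB q ((nn i : ℤ) + ((i : ℕ) + 1) * (L : ℤ) -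
      2 * (∑ l ∈ Finset.Icc 1 ((i : ℕ) + 1), (NN nn l : ℤ)) -
      alph ((i : ℕ) + 1) s - alph ((i : ℕ) + 1) b) (nn i)


abbrev K : Type := RatFunc ℚ


namespace AGV
open Finset

def qb (q : ℂ) (L n : ℕ) : ℂ := qP q L / (qP q n * qP q (L - n))

lemma one_sub_ne {q : ℂ} (hq : ‖q‖ < 1) {n : ℕ} (hn : n ≠ 0) : (1 : ℂ) - q ^ n ≠ 0 := by
  intro h
  have h1 : ‖q ^ n‖ = 1 := by rw [← sub_eq_zero.mp h]; simp
  rw [norm_pow] at h1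
  have := pow_lt_one₀ (norm_nonneg q) hq hn
  linarith

lemma qP_ne {q : ℂ} (hq : ‖q‖ < 1) (n : ℕ) : qP q n ≠ 0 :=
  Finset.prod_ne_zero_iff.mpr fun _ _ => one_sub_ne hq (Nat.succ_ne_zero _)

lemma qP_succ (q : ℂ) (n : ℕ) : qP q (n + 1) = qP q n * (1 - q ^ (n + 1)) := by
  unfold qP; rw [Finset.prod_range_succ]

lemma qP_zero (q : ℂ) : qP q 0 = 1 := by simp [qP]

lemma qb_left {q : ℂ} (hq : ‖q‖ < 1) (L n : ℕ) (h : n ≤ L) :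
    qb q (L + 1) (n + 1) * (1 - q ^ (n + 1)) = (1 - q ^ (L + 1)) * qb q L n := by
  have h1 := qP_ne hq n
  have h2 := qP_ne hq (L - n)
  have h3 := one_sub_ne hq (Nat.succ_ne_zero n)
  unfold qb
  rw [Nat.add_sub_add_right, qP_succ, qP_succ]
  field_simp

lemma qb_right {q : ℂ} (hq : ‖q‖ < 1) (L n : ℕ) (h : n ≤ L) :
    qb q (L + 1) n * (1 - q ^ (L + 1 - n)) = (1 - q ^ (L + 1)) * qb q L n := by
  have h1 := qP_ne hq n
  have h2 := qP_ne hq (L - n)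
  obtain ⟨k, rfl⟩ := Nat.exists_eq_add_of_le h
  have e : n + k + 1 - n = k + 1 := by omega
  have h3 := one_sub_ne hq (Nat.succ_ne_zero k)
  unfold qb
  rw [e, qP_succ, qP_succ] at *
  have e : n + k - n = k := by omega
  rw [e] at *
  field_simp

lemma sumA {q : ℂ} (hq : ‖q‖ < 1) (L : ℕ) (f : ℕ → ℂ) :
    ∑ n ∈ range (L + 1), qb q L n * (1 - q ^ n) * f n =
      (1 - q ^ L) * ∑ n ∈ range (L - 1 + 1), qb q (L - 1) n * f (n + 1) := by
  rcases L with _ | L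
  · simp
  rw [Finset.sum_range_succ', Finset.mul_sum]
  simp only [pow_zero, sub_self, mul_zero, zero_mul, add_zero, Nat.add_sub_cancel]
  refine Finset.sum_congr rfl fun n hn => ?_
  rw [qb_left hq L n (by simpa [Nat.lt_succ_iff] using hn)]
  ring

lemma sumB {q : ℂ} (hq : ‖q‖ < 1) (L : ℕ) (f : ℕ → ℂ) :
    ∑ n ∈ range (L + 1), qb q L n * (1 - q ^ (L - n)) * f n =
      (1 - q ^ L) * ∑ n ∈ range (L - 1 + 1), qb q (L - 1) n * f n := by
  rcases L with _ | L
  · simp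
  rw [Finset.sum_range_succ, Finset.mul_sum]
  rw [Nat.sub_self, pow_zero, sub_self, mul_zero, zero_mul, add_zero, Nat.add_sub_cancel]
  refine Finset.sum_congr rfl fun n hn => ?_
  rw [qb_right hq L n (by simpa [Nat.lt_succ_iff] using hn)]
  ring

lemma sumAB {q : ℂ} (hq : ‖q‖ < 1) (L : ℕ) (f : ℕ → ℂ) :
    ∑ n ∈ range (L + 1), qb q L n * (1 - q ^ (L - n)) * f (n + 1) =
      ∑ n ∈ range (L + 1), qb q L n * (1 - q ^ n) * f n := by
  rw [sumA hq, sumB hq L (fun n => f (n + 1))]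

/-- peeling substitution -/
def pe (q : ℂ) (N n : ℕ) (φ : ℤ → ℂ) : ℤ → ℂ :=
  fun a => q ^ (2 * (n : ℤ) * a) * φ (a + (N : ℤ) * n)

/-- shift substitution -/
def sh (q : ℂ) (r : ℕ) (φ : ℤ → ℂ) : ℤ → ℂ := fun a => q ^ (a + (r : ℤ)) * φ (a + r)

def PP (q : ℂ) : ℕ → ℕ → ℕ → (ℤ → ℂ) → ℂ
  | 0, _, _, φ => φ 0
  | ν + 1, s, L, φ => ∑ n ∈ range (L + 1),
      qb q L n * (q ^ ((ν + 1) * n ^ 2 + (ν + 1 - s) * n) * PP q ν s (L - n) (pe q (ν + 1) n φ))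

lemma PP_zero_lev (q : ℂ) (s L : ℕ) (φ : ℤ → ℂ) : PP q 0 s L φ = φ 0 := rfl

lemma PP_succ (q : ℂ) (ν s L : ℕ) (φ : ℤ → ℂ) : PP q (ν + 1) s L φ = ∑ n ∈ range (L + 1),
      qb q L n * (q ^ ((ν + 1) * n ^ 2 + (ν + 1 - s) * n) * PP q ν s (L - n) (pe q (ν + 1) n φ)) := rfl

lemma pe_smul (q : ℂ) (N n : ℕ) (c : ℂ) (φ : ℤ → ℂ) : pe q N n (c • φ) = c • pe q N n φ := by
  ext a; simp [pe]; ring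

lemma pe_add (q : ℂ) (N n : ℕ) (φ ψ : ℤ → ℂ) : pe q N n (φ + ψ) = pe q N n φ + pe q N n ψ := by
  ext a; simp [pe]; ring

lemma PP_smul (q : ℂ) (c : ℂ) : ∀ (ν s L : ℕ) (φ : ℤ → ℂ), PP q ν s L (c • φ) = c * PP q ν s L φ
  | 0, s, L, φ => by simp [PP]
  | ν + 1, s, L, φ => by
    rw [PP_succ, PP_succ, Finset.mul_sum]
    refine Finset.sum_congr rfl fun n _ => ?_
    rw [pe_smul, PP_smul]; ring

lemma PP_add (q : ℂ) : ∀ (ν s L : ℕ) (φ ψ : ℤ → ℂ),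
    PP q ν s L (φ + ψ) = PP q ν s L φ + PP q ν s L ψ
  | 0, s, L, φ, ψ => by simp [PP]
  | ν + 1, s, L, φ, ψ => by
    rw [PP_succ, PP_succ, PP_succ, ← Finset.sum_add_distrib]
    refine Finset.sum_congr rfl fun n _ => ?_
    rw [pe_add, PP_add]; ring

lemma PP_big (q : ℂ) : ∀ (ν s L : ℕ) (φ : ℤ → ℂ), ν ≤ s → PP q ν s L φ = PP q ν ν L φ
  | 0, s, L, φ, _ => rfl
  | ν + 1, s, L, φ, h => by
    rw [PP_succ, PP_succ]
    refine Finset.sum_congr rfl fun n _ => ?_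
    rw [PP_big q ν s _ _ (by omega), PP_big q ν (ν + 1) _ _ (by omega)]
    rw [Nat.sub_eq_zero_of_le h, Nat.sub_self]

lemma qb_zero (q : ℂ) : qb q 0 0 = 1 := by simp [qb, qP]

lemma PP_L0 (q : ℂ) : ∀ (ν s : ℕ) (φ : ℤ → ℂ), PP q ν s 0 φ = φ 0
  | 0, s, φ => rfl
  | ν + 1, s, φ => by
    rw [PP_succ]
    simp [PP_L0 q ν s, qb_zero, pe]

lemma pe_sh {q : ℂ} (h0 : q ≠ 0) (N n r : ℕ) (φ : ℤ → ℂ) :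
    pe q N n (sh q r φ) = (q ^ ((N : ℤ) * n - 2 * n * r)) • sh q r (pe q N n φ) := by
  ext a
  simp only [pe, sh, Pi.smul_apply, smul_eq_mul]
  rw [show a + (N : ℤ) * n + r = a + r + (N : ℤ) * n by ring]
  simp only [← mul_assoc, ← zpow_add₀ h0]
  congr 2
  ring

lemma sh_sh {q : ℂ} (h0 : q ≠ 0) (N n r r' : ℕ) (h : r + r' = N) (φ : ℤ → ℂ) :
    sh q r' (sh q r (pe q N n φ)) = (q ^ (r' + N * (2 * n + 1))) • pe q N (n + 1) φ := by
  subst h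
  ext a
  simp only [pe, sh, Pi.smul_apply, smul_eq_mul]
  rw [show a + (r' : ℤ) + r + ((r + r' : ℕ) : ℤ) * n = a + ((r + r' : ℕ) : ℤ) * ((n + 1 : ℕ) : ℤ) by
    push_cast; ring]
  rw [← zpow_natCast]
  simp only [← mul_assoc, ← zpow_add₀ h0]
  congr 2
  push_cast
  ring

lemma PP_z {q : ℂ} (h0 : q ≠ 0) : ∀ (ν L : ℕ) (φ : ℤ → ℂ),
    PP q ν 0 L φ = PP q ν ν L (sh q 0 φ)
  | 0, L, φ => by simp [PP, sh]
  | ν + 1, L, φ => by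
    rw [PP_succ, PP_succ]
    refine Finset.sum_congr rfl fun n _ => ?_
    rw [PP_z h0 ν, PP_big q ν (ν + 1) _ _ (by omega), pe_sh h0, PP_smul, ← mul_assoc (q ^ _) (q ^ _),
      ← zpow_natCast, ← zpow_natCast, ← zpow_add₀ h0]
    congr 3
    simp

lemma III0 {q : ℂ} (h0 : q ≠ 0) (hq : ‖q‖ < 1) : ∀ (ν L : ℕ) (φ : ℤ → ℂ),
    PP q ν 0 L φ - q ^ L * PP q ν 1 L φ = (1 - q ^ L) * PP q ν ν (L - 1) (sh q 0 φ)
  | 0, L, φ => by simp [PP, sh]; ring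
  | ν + 1, L, φ => by
    rw [PP_succ, PP_succ, PP_succ, ← sumB hq, Finset.mul_sum, ← Finset.sum_sub_distrib]
    refine Finset.sum_congr rfl fun n hn => ?_
    have hn : n ≤ L := by simpa [Nat.lt_succ_iff] using hn
    have IH := III0 h0 hq ν (L - n) (pe q (ν + 1) n φ)
    rw [PP_big q ν (ν + 1) _ _ (by omega), pe_sh h0, PP_smul]
    have e1 : q ^ L = q ^ (L - n) * q ^ n := by rw [← pow_add]; congr 1; omega
    have e2 : q ^ (((ν + 1 : ℕ) : ℤ) * n - 2 * n * ((0 : ℕ) : ℤ)) = q ^ ((ν + 1) * n) := by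
      rw [← zpow_natCast]; congr 1
    rw [e1, e2, Nat.sub_right_comm, Nat.sub_self, Nat.zero_mul, Nat.add_zero, Nat.sub_zero,
      Nat.add_sub_cancel, pow_add, pow_add]
    have e3 : q ^ ((ν + 1) * n) = q ^ (ν * n) * q ^ n := by rw [← pow_add]; congr 1; ring
    rw [e3]
    linear_combination (qb q L n * q ^ ((ν + 1) * n ^ 2) * q ^ (ν * n) * q ^ n) * IH

lemma IIItop {q : ℂ} (h0 : q ≠ 0) (hq : ‖q‖ < 1) (ν L : ℕ) (φ : ℤ → ℂ) :
    PP q (ν + 1) (ν + 1) L φ - PP q (ν + 1) ν L φ =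
      (1 - q ^ L) * PP q (ν + 1) 0 (L - 1) (sh q (ν + 1) φ) := by
  rw [PP_succ, PP_succ, PP_succ, ← sumB hq, ← Finset.sum_sub_distrib]
  let f : ℕ → ℂ := fun n => q ^ ((ν + 1) * n ^ 2) * PP q ν ν (L - n) (pe q (ν + 1) n φ)
  trans ∑ n ∈ range (L + 1), qb q L n * (1 - q ^ n) * f n
  · refine Finset.sum_congr rfl fun n hn => ?_
    rw [PP_big q ν (ν + 1) _ _ (by omega), Nat.sub_self, Nat.add_sub_cancel_left, pow_add, pow_add]
    simp only [Nat.zero_mul, Nat.one_mul, pow_zero, f]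
    ring
  · rw [← sumAB hq]
    refine Finset.sum_congr rfl fun n hn => ?_
    rw [pe_sh h0, PP_smul, PP_z h0, sh_sh h0 _ _ _ _ (by ring), PP_smul]
    simp only [f]
    rw [Nat.sub_right_comm, ← Nat.sub_add_eq]
    have : q ^ ((ν + 1) * (n + 1) ^ 2) = q ^ ((ν + 1) * n ^ 2 + (ν + 1 - 0) * n) *
      (q ^ (((ν + 1 : ℕ) : ℤ) * n - 2 * n * ((ν + 1 : ℕ) : ℤ)) * q ^ (0 + (ν + 1) * (2 * n + 1))) := by
      simp only [← zpow_natCast, ← zpow_add₀ h0]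
      congr 1
      push_cast
      simp
      ring
    rw [this]
    ring

lemma III_IV {q : ℂ} (h0 : q ≠ 0) (hq : ‖q‖ < 1) (ν : ℕ) :
    (∀ (s t L : ℕ) (φ : ℤ → ℂ), s + 1 + t = ν →
      PP q ν (s + 1) L φ - PP q ν s L φ - q ^ L * (PP q ν (s + 2) L φ - PP q ν (s + 1) L φ) =
        (1 - q ^ L) * PP q ν t (L - 1) (sh q (s + 1) φ)) ∧
    (∀ (r t L : ℕ) (φ : ℤ → ℂ), r + 1 + t = ν →
      PP q ν (r + 1) L φ - PP q ν r L φ =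
        PP q ν t L (sh q (r + 1) φ) - q ^ L * PP q ν (t + 1) L (sh q (r + 1) φ)) := by
  induction ν with
  | zero => exact ⟨fun _ _ _ _ h => by omega, fun _ _ _ _ h => by omega⟩
  | succ ν ih =>
    obtain ⟨ih3, ih4⟩ := ih
    constructor
    · intro s t L φ h
      rcases t with _ | t
      · obtain rfl : s = ν := by omega
        rw [PP_big q (s + 1) (s + 2) _ _ (by omega), sub_self, mul_zero, sub_zero]
        exact IIItop h0 hq s L φ
      have h' : s + 1 + t = ν := by omega
      let f : ℕ → ℂ := fun n => q ^ ((ν + 1) * n ^ 2 + (t + 1) * n) *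
        (PP q ν s (L - n) (pe q (ν + 1) n φ)
          - q ^ (L - n) * PP q ν (s + 1) (L - n) (pe q (ν + 1) n φ))
      have key : ∑ n ∈ range (L + 1), qb q L n * (1 - q ^ (L - n)) * f (n + 1) =
        ∑ n ∈ range (L + 1), qb q L n * (1 - q ^ (L - n)) *
          (q ^ ((ν + 1) * n ^ 2 + (t + 1) * n) *
            (PP q ν (t + 1) (L - n - 1) (sh q (s + 1) (pe q (ν + 1) n φ)) -
              PP q ν t (L - n - 1) (sh q (s + 1) (pe q (ν + 1) n φ)))) := by
        refine Finset.sum_congr rfl fun n hn => ?_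
        rw [ih4 t s _ _ (by omega), sh_sh h0 _ _ _ _ (by omega), PP_smul, PP_smul]
        simp only [f, ← Nat.sub_add_eq]
        have : q ^ ((ν + 1) * (n + 1) ^ 2 + (t + 1) * (n + 1)) =
            q ^ ((ν + 1) * n ^ 2 + (t + 1) * n) * q ^ (t + 1 + (ν + 1) * (2 * n + 1)) := by
          rw [← pow_add]; congr 1; ring
        rw [this]; ring
      rw [sumAB hq] at key
      rw [PP_succ, PP_succ, PP_succ, PP_succ, ← sumB hq, ← Finset.sum_sub_distrib,
        ← Finset.sum_sub_distrib, Finset.mul_sum, ← Finset.sum_sub_distrib]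
      have key2 : ∑ n ∈ range (L + 1), qb q L n * (1 - q ^ (L - n)) *
          (q ^ ((ν + 1) * n ^ 2 + (ν + 1 - (t + 1)) * n) *
            PP q ν (t + 1) (L - 1 - n) (pe q (ν + 1) n (sh q (s + 1) φ))) =
          ∑ n ∈ range (L + 1), qb q L n * (1 - q ^ (L - n)) *
          (q ^ ((ν + 1) * n ^ 2 + (t + 1) * n) *
            PP q ν (t + 1) (L - n - 1) (sh q (s + 1) (pe q (ν + 1) n φ))) := by
        refine Finset.sum_congr rfl fun n hn => ?_
        rw [pe_sh h0, PP_smul, Nat.sub_right_comm]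
        have : q ^ ((ν + 1) * n ^ 2 + (t + 1) * n) = q ^ ((ν + 1) * n ^ 2 + (ν + 1 - (t + 1)) * n) *
            q ^ (((ν + 1 : ℕ) : ℤ) * n - 2 * n * ((s + 1 : ℕ) : ℤ)) := by
          rw [show ν + 1 - (t + 1) = s + 1 by omega]
          simp only [← zpow_natCast, ← zpow_add₀ h0]
          congr 1
          subst h'
          push_cast
          ring
        rw [this]; ring
      rw [key2, ← sub_eq_zero, ← Finset.sum_sub_distrib]
      rw [← sub_eq_zero, ← Finset.sum_sub_distrib] at key
      rw [← key]
      refine Finset.sum_congr rfl fun n hn => ?_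
      have hn : n ≤ L := by simpa [Nat.lt_succ_iff] using hn
      have e1 : q ^ L = q ^ (L - n) * q ^ n := by rw [← pow_add]; congr 1; omega
      have IH := ih3 s t (L - n) (pe q (ν + 1) n φ) h'
      rw [show ν + 1 - (s + 1) = t + 1 by omega, show ν + 1 - s = t + 2 by omega,
        show ν + 1 - (s + 2) = t by omega]
      have e2 : q ^ ((ν + 1) * n ^ 2 + (t + 1) * n) = q ^ ((ν + 1) * n ^ 2 + t * n) * q ^ n := by
        rw [← pow_add]; congr 1; ring
      have e3 : q ^ ((ν + 1) * n ^ 2 + (t + 2) * n) = q ^ ((ν + 1) * n ^ 2 + t * n) * q ^ n * q ^ n := by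
        rw [← pow_add, ← pow_add]; congr 1; ring
      simp only [f]
      rw [e2, e3, e1]
      linear_combination (qb q L n * q ^ ((ν + 1) * n ^ 2 + t * n) * q ^ n) * IH
    · intro r t L φ h
      rcases t with _ | t
      · obtain rfl : r = ν := by omega
        rw [IIItop h0 hq, zero_add, III0 h0 hq, PP_z h0]
      have h' : r + 1 + t = ν := by omega
      let f : ℕ → ℂ := fun n => q ^ ((ν + 1) * n ^ 2 + (t + 1) * n) *
        PP q ν r (L - n) (pe q (ν + 1) n φ)
      have key := sumAB hq L f
      rw [PP_succ, PP_succ, PP_succ, PP_succ, ← Finset.sum_sub_distrib, Finset.mul_sum,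
        ← Finset.sum_sub_distrib, ← sub_eq_zero, ← Finset.sum_sub_distrib]
      rw [eq_comm, ← sub_eq_zero, ← Finset.sum_sub_distrib] at key
      rw [← key]
      refine Finset.sum_congr rfl fun n hn => ?_
      have hn : n ≤ L := by simpa [Nat.lt_succ_iff] using hn
      have e1 : q ^ L = q ^ (L - n) * q ^ n := by rw [← pow_add]; congr 1; omega
      have IH4 := ih4 r t (L - n) (pe q (ν + 1) n φ) h'
      have IH3 := ih3 t r (L - n) (sh q (r + 1) (pe q (ν + 1) n φ)) (by omega)
      rw [sh_sh h0 _ _ _ _ (by omega), PP_smul] at IH3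
      simp only [f, ← Nat.sub_add_eq] at IH3 ⊢
      rw [pe_sh h0, PP_smul, PP_smul]
      have e4 : q ^ ((ν + 1) * (n + 1) ^ 2 + (t + 1) * (n + 1)) =
            q ^ ((ν + 1) * n ^ 2 + (t + 1) * n) * q ^ (t + 1 + (ν + 1) * (2 * n + 1)) := by
          rw [← pow_add]; congr 1; ring
      have e5 : q ^ ((ν + 1) * n ^ 2 + (t + 1) * n) = q ^ ((ν + 1) * n ^ 2 + r * n) * q ^ n *
            q ^ (((ν + 1 : ℕ) : ℤ) * n - 2 * n * ((r + 1 : ℕ) : ℤ)) := by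
          simp only [← zpow_natCast, ← zpow_add₀ h0]
          congr 1
          subst h'
          push_cast
          ring
      rw [show ν + 1 - (r + 1) = t + 1 by omega, show ν + 1 - r = t + 2 by omega,
        show ν + 1 - (t + 1) = r + 1 by omega, show ν + 1 - (t + 1 + 1) = r by omega]
      have e3 : q ^ ((ν + 1) * n ^ 2 + (t + 2) * n) = q ^ ((ν + 1) * n ^ 2 + (t + 1) * n) * q ^ n := by
        rw [← pow_add]; congr 1; ring
      have e6 : q ^ ((ν + 1) * n ^ 2 + (r + 1) * n) = q ^ ((ν + 1) * n ^ 2 + r * n) * q ^ n := by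
        rw [← pow_add]; congr 1; ring
      rw [e4, e3, e6, e1, e5]
      linear_combination (qb q L n * (q ^ ((ν + 1) * n ^ 2 + r * n) * q ^ n *
            q ^ (((ν + 1 : ℕ) : ℤ) * n - 2 * n * ((r + 1 : ℕ) : ℤ)))) * (IH4 - IH3)
end AGV

namespace AGV
open Finset

lemma FF {q : ℂ} (h0 : q ≠ 0) (hq : ‖q‖ < 1) (ν L : ℕ) (φ : ℤ → ℂ) : ∀ s : ℕ, s ≤ ν →
    PP q ν s L φ - q ^ L * PP q ν (s + 1) L φ =
      (1 - q ^ L) * ∑ t ∈ range (s + 1), PP q ν (ν - t) (L - 1) (sh q t φ)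
  | 0, _ => by simpa using III0 h0 hq ν L φ
  | s + 1, h => by
    have IH := FF h0 hq ν L φ s (by omega)
    have h3 := (III_IV h0 hq ν).1 s (ν - (s + 1)) L φ (by omega)
    rw [Finset.sum_range_succ, mul_add, ← IH, ← h3]
    ring

/-- weighted functional -/
def BB (q : ℂ) (ν L p : ℕ) (ψ : ℤ → ℂ) : ℂ :=
  PP q ν (ν - p) L (fun a => q ^ (-(L : ℤ) * a) * ψ a)

lemma BB_smul (q : ℂ) (ν L p : ℕ) (c : ℂ) (ψ : ℤ → ℂ) :
    BB q ν L p (fun a => c * ψ a) = c * BB q ν L p ψ := by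
  unfold BB
  rw [← PP_smul]
  congr 1
  ext a
  simp only [Pi.smul_apply, smul_eq_mul]
  ring

def ff (q : ℂ) (ν L m : ℕ) (ψ : ℤ → ℂ) : ℂ :=
  ∑ t ∈ range (m + 1), q ^ (-(L : ℤ) * t) * BB q ν L t (fun a => ψ (a + t))

lemma sum_ff {q : ℂ} (h0 : q ≠ 0) (ν L m : ℕ) (ψ : ℤ → ℂ) :
    ∑ t ∈ range (m + 1), PP q ν (ν - t) L
      (sh q t (fun a => q ^ (-((L + 1 : ℕ) : ℤ) * a) * ψ a)) = ff q ν L m ψ := by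
  unfold ff
  refine Finset.sum_congr rfl fun t _ => ?_
  rw [← BB_smul]
  unfold BB
  congr 1
  ext a
  simp only [sh]
  rw [← mul_assoc, ← mul_assoc, ← zpow_add₀ h0, ← zpow_add₀ h0]
  congr 2
  push_cast; ring

lemma BB_step {q : ℂ} (h0 : q ≠ 0) (hq : ‖q‖ < 1) (ν L p : ℕ) (hp : p + 1 ≤ ν) (ψ : ℤ → ℂ) :
    BB q ν (L + 1) (p + 1) ψ - q ^ (L + 1) * BB q ν (L + 1) p ψ =
      (1 - q ^ (L + 1)) * ff q ν L (ν - (p + 1)) ψ := by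
  rw [← sum_ff h0]
  have := FF h0 hq ν (L + 1) (fun a => q ^ (-((L + 1 : ℕ) : ℤ) * a) * ψ a) (ν - (p + 1)) (by omega)
  rw [show ν - (p + 1) + 1 = ν - p by omega] at this ⊢
  exact this

lemma BB_zero {q : ℂ} (h0 : q ≠ 0) (hq : ‖q‖ < 1) (ν L : ℕ) (ψ : ℤ → ℂ) :
    BB q ν (L + 1) 0 ψ = ff q ν L ν ψ := by
  rw [← sum_ff h0]
  have := FF h0 hq ν (L + 1) (fun a => q ^ (-((L + 1 : ℕ) : ℤ) * a) * ψ a) ν le_rfl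
  rw [PP_big q ν (ν + 1) _ _ (by omega)] at this
  have h2 := one_sub_ne hq (Nat.succ_ne_zero L)
  apply mul_left_cancel₀ h2
  rw [Nat.add_sub_cancel] at this
  rw [Nat.succ_eq_add_one, ← this]
  simp only [BB, Nat.sub_zero]
  ring

def M2 (q : ℂ) (ν L : ℕ) : Prop :=
  ∀ ψ : ℤ → ℂ, BB q ν L 0 ψ = BB q ν L 0 (fun a => ψ ((ν : ℤ) * L - a))

def M3 (q : ℂ) (ν L : ℕ) : Prop :=
  ∀ (p : ℕ) (ψ : ℤ → ℂ), p < ν → BB q ν L p ψ - q ^ (-(L : ℤ)) * BB q ν L (p + 1) ψ =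
    BB q ν L p (fun a => ψ ((ν : ℤ) * L - p - 1 - a)) -
      q ^ (-(L : ℤ)) * BB q ν L (p + 1) (fun a => ψ ((ν : ℤ) * L - p - 1 - a))

lemma ff_tel {q : ℂ} (h0 : q ≠ 0) {ν L : ℕ} (h2 : M2 q ν L) (h3 : M3 q ν L) (ψ : ℤ → ℂ) :
    ∀ m : ℕ, m ≤ ν → ff q ν L m ψ =
      q ^ (-(L : ℤ) * m) * BB q ν L m (fun a => ψ ((ν : ℤ) * L - a)) +
      ∑ t ∈ range m, q ^ (-(L : ℤ) * t) * BB q ν L t (fun a => ψ (a + t + 1))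
  | 0, _ => by
    simp only [ff, zero_add, Finset.sum_range_one, Finset.range_zero, Finset.sum_empty]
    simp [h2 ψ]
  | m + 1, hm => by
    have IH := ff_tel h0 h2 h3 ψ m (by omega)
    have h := h3 m (fun a => ψ (a + m + 1)) (by omega)
    have e : ff q ν L (m + 1) ψ = ff q ν L m ψ +
       q ^ (-(L : ℤ) * (m + 1 : ℕ)) * BB q ν L (m + 1) (fun a => ψ (a + (m + 1 : ℕ))) := by
      unfold ff; rw [Finset.sum_range_succ _ (m + 1)]
    rw [e, IH, Finset.sum_range_succ]
    have e2 : q ^ (-(L : ℤ) * (m + 1 : ℕ)) = q ^ (-(L : ℤ) * m) * q ^ (-(L : ℤ)) := by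
      rw [← zpow_add₀ h0]; congr 1; push_cast; ring
    rw [e2]
    have e3 : (fun a : ℤ => ψ (a + (m + 1 : ℕ))) = fun a => ψ (a + m + 1) := by
      ext a; congr 1; push_cast; ring
    rw [e3]
    have e4 : (fun a : ℤ => ψ ((ν : ℤ) * L - m - 1 - a + m + 1)) = fun a => ψ ((ν : ℤ) * L - a) := by
      ext a; congr 1; ring
    rw [e4] at h
    linear_combination -q ^ (-(L : ℤ) * m) * h

lemma ff_sym {q : ℂ} (h0 : q ≠ 0) {ν L : ℕ} (h2 : M2 q ν L) (h3 : M3 q ν L) :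
    ∀ (m : ℕ) (ψ : ℤ → ℂ), m ≤ ν → ff q ν L m ψ = ff q ν L m (fun a => ψ ((ν : ℤ) * L + m - a))
  | 0, ψ, _ => by
    simp only [ff, zero_add, Finset.sum_range_one]
    simp [h2 ψ]
  | m + 1, ψ, hm => by
    rw [ff_tel h0 h2 h3 ψ _ hm]
    have IH := ff_sym h0 h2 h3 m (fun a => ψ (a + 1)) (by omega)
    have e : ∑ t ∈ range (m + 1), q ^ (-(L : ℤ) * t) * BB q ν L t (fun a => ψ (a + t + 1)) =
      ff q ν L m (fun a => ψ (a + 1)) := rfl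
    rw [e, IH]
    unfold ff
    rw [Finset.sum_range_succ _ (m + 1), add_comm]
    congr 1
    · refine Finset.sum_congr rfl fun t _ => ?_
      congr 2
      ext a; show ψ _ = ψ _; congr 1; push_cast; ring
    · congr 2
      ext a; congr 1; push_cast; ring

lemma M23 {q : ℂ} (h0 : q ≠ 0) (hq : ‖q‖ < 1) (ν : ℕ) : ∀ L : ℕ, M2 q ν L ∧ M3 q ν L
  | 0 => by
    constructor
    · intro ψ; simp [BB, PP_L0]
    · intro p ψ _; simp [BB, PP_L0]
  | L + 1 => by
    obtain ⟨h2, h3⟩ := M23 h0 hq ν L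
    constructor
    · intro ψ
      rw [BB_zero h0 hq, BB_zero h0 hq, ff_sym h0 h2 h3 _ _ le_rfl]
      congr 1
    · intro p ψ hp
      have a1 := BB_step h0 hq ν L p hp ψ
      have a2 := BB_step h0 hq ν L p hp (fun a => ψ ((ν : ℤ) * (L + 1 : ℕ) - p - 1 - a))
      rw [ff_sym h0 h2 h3 _ _ (by omega)] at a1
      have e : (fun a : ℤ => ψ ((ν : ℤ) * L + (ν - (p + 1) : ℕ) - a)) =
         (fun a => ψ ((ν : ℤ) * (L + 1 : ℕ) - p - 1 - a)) := by
        ext a; congr 1; push_cast [Nat.cast_sub (show p + 1 ≤ ν from hp)]; ring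
      rw [e, ← a2] at a1
      have hu : q ^ (-((L + 1 : ℕ) : ℤ)) * q ^ (L + 1) = 1 := by
        rw [← zpow_natCast, ← zpow_add₀ h0]; simp
      linear_combination (-q ^ (-((L + 1 : ℕ) : ℤ))) * a1 - (BB q ν (L + 1) p ψ - BB q ν (L + 1) p (fun a => ψ ((ν : ℤ) * (L + 1 : ℕ) - p - 1 - a))) * hu
end AGV

namespace AGV
open Finset

lemma G_sym {q : ℂ} (h0 : q ≠ 0) (hq : ‖q‖ < 1) (ν L n : ℕ) (hn : n ≤ ν) (T : ℤ → ℂ)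
    (h1 : ∀ A, T (-(2 * ν + 3) - A) = T A) (e : ℤ) :
    ff q ν L n (fun a => T (2 * a - 1 - ν * (L + 1) + e)) =
      ff q ν L n (fun a => T (2 * a - 1 - ν * (L + 1) + (-2 * n - 1 - e))) := by
  obtain ⟨h2, h3⟩ := M23 h0 hq ν L
  rw [ff_sym h0 h2 h3 n _ hn]
  congr 1
  ext a
  show T _ = T _
  rw [← h1]
  congr 1
  ring

lemma H_sum {q : ℂ} (h0 : q ≠ 0) (hq : ‖q‖ < 1) (ν L : ℕ) (T : ℤ → ℂ)
    (h1 : ∀ A, T (-(2 * ν + 3) - A) = T A) : ∀ n : ℕ, n ≤ ν →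
    ff q ν L n (fun a => T (2 * a - 1 - ν * (L + 1) + (-(n : ℤ)))) =
      ∑ t ∈ range (n + 1), q ^ (-(L : ℤ) * t) *
        BB q ν L t (fun a => T (2 * a + t - 1 - ν * (L + 1)))
  | 0, _ => by
    simp only [ff, zero_add, Finset.sum_range_one]
    simp
  | n + 1, hn => by
    rw [Finset.sum_range_succ, ← H_sum h0 hq ν L T h1 n (by omega), G_sym h0 hq ν L n (by omega) T h1]
    unfold ff
    rw [Finset.sum_range_succ _ (n + 1)]
    congr 1
    · refine Finset.sum_congr rfl fun t _ => ?_
      congr 2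
      ext a
      show T _ = T _
      congr 1
      push_cast; ring
    · congr 2
      ext a
      show T _ = T _
      congr 1
      push_cast; ring

/-- `Ξ` -/
def Xi (q : ℂ) (ν : ℕ) (T : ℤ → ℂ) (L p : ℕ) : ℂ :=
  BB q ν L p (fun a => T (2 * a + p - 1 - ν * (L + 1)))

lemma BB_eq {q : ℂ} (h0 : q ≠ 0) (hq : ‖q‖ < 1) (ν L p : ℕ) (hp : p + 1 ≤ ν) (T : ℤ → ℂ)
    (h2 : ∀ A, T (-A) = - (q ^ A * T A)) :
    BB q ν L (p + 1) (fun a => T (2 * a + p - ν * (L + 1))) =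
      BB q ν L p (fun a => T (2 * a + p - ν * (L + 1))) := by
  obtain ⟨r, rfl⟩ := Nat.exists_eq_add_of_le' hp
  set ν := r + (p + 1) with hν
  have h4 := (III_IV h0 hq ν).2 r p L
    (fun a => q ^ (-(L : ℤ) * a) * T (2 * a + p - ν * (L + 1))) (by omega)
  have m3 := (M23 h0 hq ν L).2 r
    (fun a : ℤ => q ^ (a + (r + 1) - L * (r + 1)) * T (2 * a + (r + 1) - ν * L)) (by omega)
  have e : (fun a : ℤ => q ^ (((ν : ℤ) * L - r - 1 - a) + (r + 1) - L * (r + 1)) *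
      T (2 * ((ν : ℤ) * L - r - 1 - a) + (r + 1) - ν * L)) =
      fun a : ℤ => (-1) * (q ^ (a + (r + 1) - L * (r + 1)) * T (2 * a + (r + 1) - ν * L)) := by
    ext a
    rw [show 2 * ((ν : ℤ) * L - r - 1 - a) + (r + 1) - ν * L =
      - (2 * a + (r + 1) - ν * L) by ring, h2]
    have : q ^ (a + ((r : ℤ) + 1) - L * (r + 1)) =
      q ^ (((ν : ℤ) * L - r - 1 - a) + (r + 1) - L * (r + 1)) * q ^ (2 * a + ((r : ℤ) + 1) - ν * L) := by
      rw [← zpow_add₀ h0]; congr 1; ring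
    rw [this]; ring
  rw [e, BB_smul, BB_smul] at m3
  have e1 : sh q (r + 1) (fun a => q ^ (-(L : ℤ) * a) * T (2 * a + p - ν * (L + 1))) =
      fun a => q ^ (-(L : ℤ) * a) * (q ^ (a + (r + 1) - L * (r + 1)) * T (2 * a + (r + 1) - ν * L)) := by
    ext a
    simp only [sh]
    rw [← mul_assoc, ← mul_assoc, ← zpow_add₀ h0, ← zpow_add₀ h0]
    congr 2
    · push_cast; ring
    · rw [hν]; push_cast; ring
  rw [e1] at h4
  have b1 : ν - (r + 1) = p := by omega
  have b2 : ν - r = p + 1 := by omega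
  have b3 : ν - (p + 1) = r := by omega
  have b4 : ν - p = r + 1 := by omega
  unfold BB at *
  rw [b1, b2] at m3
  rw [b3, b4]
  have hu : q ^ (-(L : ℤ)) * q ^ L = 1 := by
    rw [← zpow_natCast, ← zpow_add₀ h0]; simp
  have hz : q ^ L ≠ 0 := pow_ne_zero _ h0
  generalize PP q ν p L _ = X at *
  generalize PP q ν (p + 1) L (fun a => q ^ (-(L : ℤ) * a) * (q ^ (a + (r + 1) - L * (r + 1)) * T (2 * a + (r + 1) - ν * L))) = Y at *
  linear_combination -h4 + q ^ L / 2 * m3 + X * hu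

lemma Xi_rec {q : ℂ} (h0 : q ≠ 0) (hq : ‖q‖ < 1) (ν L : ℕ) (T : ℤ → ℂ)
    (h1 : ∀ A, T (-(2 * ν + 3) - A) = T A) (h2 : ∀ A, T (-A) = - (q ^ A * T A)) (p : ℕ)
    (hp : p ≤ ν) :
    Xi q ν T (L + 1) p = ∑ t ∈ range (ν - p + 1), q ^ (-(L : ℤ) * t) * Xi q ν T L t := by
  have := H_sum h0 hq ν L T h1 (ν - p) (by omega)
  unfold Xi
  rw [← this]
  have e : (fun a : ℤ => T (2 * a + p - 1 - ν * (((L + 1 : ℕ) : ℤ) + 1))) =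
     (fun a => T (2 * a - 1 - ν * (L + 1) + (-((ν - p : ℕ) : ℤ)))) := by
    ext a; congr 1; push_cast [Nat.cast_sub hp]; ring
  rw [e]
  rcases p with _ | p
  · exact BB_zero h0 hq ν L _
  · rw [← e]
    have h3 := BB_eq h0 hq ν (L + 1) p hp T h2
    have e' : (fun a : ℤ => T (2 * a + p - ν * (((L + 1 : ℕ) : ℤ) + 1))) =
      (fun a : ℤ => T (2 * a + (p + 1 : ℕ) - 1 - ν * (((L + 1 : ℕ) : ℤ) + 1))) := by
      ext a; congr 1; push_cast; ring
    rw [e'] at h3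
    have h4 := BB_step h0 hq ν L p hp (fun a : ℤ => T (2 * a + (p + 1 : ℕ) - 1 - ν * (((L + 1 : ℕ) : ℤ) + 1)))
    rw [← h3] at h4
    apply mul_left_cancel₀ (one_sub_ne hq (Nat.succ_ne_zero L))
    rw [Nat.succ_eq_add_one, ← h4]
    ring

lemma Xi_zero (q : ℂ) (ν p : ℕ) (T : ℤ → ℂ) : Xi q ν T 0 p = T (p - 1 - ν) := by
  simp [Xi, BB, PP_L0]

/-- theta -/
def Th (q : ℂ) (k : ℤ) (A : ℤ) : ℂ :=
  ∑' n : ℤ, (-1) ^ n * q ^ (k * (n * (n + 1) / 2) + n * A)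

lemma tri_neg (n : ℤ) : (-n) * (-n + 1) / 2 + n = n * (n + 1) / 2 := by
  rw [show n * (n + 1) = (-n) * (-n + 1) + n * 2 by ring, Int.add_mul_ediv_right _ _ (by norm_num)]

lemma Th1 (q : ℂ) (k A : ℤ) : Th q k (-k - A) = Th q k A := by
  unfold Th
  rw [← (Equiv.neg ℤ).tsum_eq]
  refine tsum_congr fun n => ?_
  simp only [Equiv.neg_apply]
  congr 1
  · rw [zpow_neg]; rcases Int.even_or_odd n with h | h <;> simp [h.neg_one_zpow]
  · congr 1
    have := tri_neg n
    rw [← this]; ring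

lemma Th2 {q : ℂ} (h0 : q ≠ 0) (k A : ℤ) : Th q k (-A) = - (q ^ A * Th q k A) := by
  unfold Th
  rw [← (Equiv.subLeft (-1 : ℤ)).tsum_eq, ← tsum_mul_left, ← tsum_neg]
  refine tsum_congr fun n => ?_
  simp only [Equiv.subLeft_apply]
  rw [show (-1 - n) * (-1 - n + 1) = n * (n + 1) by ring,
    show k * (n * (n + 1) / 2) + (-1 - n) * -A = A + (k * (n * (n + 1) / 2) + n * A) by ring,
    zpow_add₀ h0 A]
  have : (-1 : ℂ) ^ (-1 - n) = - (-1) ^ n := by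
    rw [zpow_sub₀ (by norm_num)]
    rcases Int.even_or_odd n with h | h <;> simp [h.neg_one_zpow]
  rw [this]; ring
end AGV

namespace AGV
open Finset

def SN {ν : ℕ} (nn : Fin ν → ℕ) : ℕ := ∑ i ∈ Icc 1 ν, NN nn i

lemma NN_snoc {ν : ℕ} (nn : Fin ν → ℕ) (n i : ℕ) (hi : i ≤ ν + 1) :
    NN (Fin.snoc nn n : Fin (ν + 1) → ℕ) i = NN nn i + n := by
  simp [NN, Fin.sum_univ_castSucc, hi]

lemma NN_top {ν : ℕ} (nn : Fin ν → ℕ) : NN nn (ν + 1) = 0 := by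
  simp only [NN]
  refine Finset.sum_eq_zero fun k _ => ?_
  have := k.2
  rw [if_neg (by omega)]

lemma SN_snoc {ν : ℕ} (nn : Fin ν → ℕ) (n : ℕ) :
    SN (Fin.snoc nn n : Fin (ν + 1) → ℕ) = SN nn + (ν + 1) * n := by
  unfold SN
  rw [Finset.sum_congr rfl fun i hi => NN_snoc nn n i (Finset.mem_Icc.mp hi).2,
    Finset.sum_add_distrib, Finset.sum_Icc_succ_top (by omega), NN_top]
  simp

lemma expAG_snoc {ν : ℕ} (s : ℕ) (nn : Fin ν → ℕ) (n : ℕ) :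
    expAG (ν + 1) s (Fin.snoc nn n : Fin (ν + 1) → ℕ) =
      expAG ν s nn + 2 * n * SN nn + (ν + 1) * n ^ 2 + (ν + 1 - s) * n := by
  unfold expAG
  rw [Finset.sum_congr rfl fun i hi => by rw [NN_snoc nn n i (Finset.mem_Icc.mp hi).2],
    Finset.sum_congr (s₁ := Icc (s + 1) (ν + 1)) rfl
      fun i hi => NN_snoc nn n i (Finset.mem_Icc.mp hi).2, Finset.sum_add_distrib]
  have e1 : ∑ i ∈ Icc 1 (ν + 1), (NN nn i + n) ^ 2 =
      ∑ i ∈ Icc 1 ν, NN nn i ^ 2 + 2 * n * SN nn + (ν + 1) * n ^ 2 := by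
    rw [Finset.sum_Icc_succ_top (by omega), NN_top]
    have : ∀ i ∈ Icc 1 ν, (NN nn i + n) ^ 2 = NN nn i ^ 2 + 2 * n * NN nn i + n ^ 2 :=
      fun i _ => by ring
    rw [Finset.sum_congr rfl this, Finset.sum_add_distrib, Finset.sum_add_distrib, ← Finset.mul_sum]
    simp [SN]; ring
  have e2 : ∑ i ∈ Icc (s + 1) (ν + 1), NN nn i = ∑ i ∈ Icc (s + 1) ν, NN nn i := by
    by_cases h : s ≤ ν
    · rw [Finset.sum_Icc_succ_top (by omega), NN_top]; simp
    · rw [Finset.Icc_eq_empty (by omega), Finset.Icc_eq_empty (by omega)]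
  have e3 : ∑ i ∈ Icc (s + 1) (ν + 1), n = (ν + 1 - s) * n := by
    rw [Finset.sum_const, Nat.card_Icc, smul_eq_mul]; congr 1; omega
  rw [e1, e2, e3]; ring

def trm (q : ℂ) (ν s L : ℕ) (φ : ℤ → ℂ) (nn : Fin ν → ℕ) : ℂ :=
  if NN nn 1 ≤ L then q ^ expAG ν s nn * φ (SN nn) *
    (qP q L / (qP q (L - NN nn 1) * ∏ i, qP q (nn i))) else 0

lemma le_NN {ν : ℕ} (nn : Fin ν → ℕ) (i : Fin ν) : nn i ≤ NN nn (i + 1) := by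
  unfold NN
  have := Finset.single_le_sum (f := fun k : Fin ν => if (i : ℕ) + 1 ≤ (k : ℕ) + 1 then nn k else 0)
    (fun _ _ => Nat.zero_le _) (Finset.mem_univ i)
  simpa using this

lemma le_NN1 {ν : ℕ} (nn : Fin ν → ℕ) (i : Fin ν) : nn i ≤ NN nn 1 := by
  unfold NN
  have := Finset.single_le_sum (f := fun k : Fin ν => if 1 ≤ (k : ℕ) + 1 then nn k else 0)
    (fun _ _ => Nat.zero_le _) (Finset.mem_univ i)
  simpa using this

lemma trm_fin (q : ℂ) (ν s L : ℕ) (φ : ℤ → ℂ) : (Function.support (trm q ν s L φ)).Finite := by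
  refine (Set.finite_Icc (0 : Fin ν → ℕ) (fun _ => L)).subset ?_
  intro nn h
  rw [Function.mem_support, trm] at h
  have : NN nn 1 ≤ L := by
    by_contra h'; simp [h'] at h
  exact ⟨fun _ => Nat.zero_le _, fun i => (le_NN1 nn i).trans this⟩

lemma trm_snoc {q : ℂ} (hq : ‖q‖ < 1) (h0 : q ≠ 0) (ν s L : ℕ) (φ : ℤ → ℂ) (nn : Fin ν → ℕ) (n : ℕ) :
    trm q (ν + 1) s L φ (Fin.snoc nn n : Fin (ν + 1) → ℕ) =
      if n ≤ L then qb q L n * (q ^ ((ν + 1) * n ^ 2 + (ν + 1 - s) * n) *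
        trm q ν s (L - n) (pe q (ν + 1) n φ) nn) else 0 := by
  unfold trm
  rw [NN_snoc _ _ _ (by omega), expAG_snoc, SN_snoc]
  by_cases h : n ≤ L
  swap
  · rw [if_neg h, if_neg (by omega)]
  rw [if_pos h]
  by_cases h2 : NN nn 1 ≤ L - n
  swap
  · rw [if_neg h2, if_neg (by omega)]; simp
  rw [if_pos h2, if_pos (by omega), Fin.prod_univ_castSucc]
  simp only [Fin.snoc_castSucc, Fin.snoc_last, pe, qb]
  have h1 := qP_ne hq (L - n)
  have h3 := qP_ne hq n
  have h4 := qP_ne hq (L - n - NN nn 1)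
  have h5 : ∏ i, qP q (nn i) ≠ 0 := Finset.prod_ne_zero_iff.mpr fun _ _ => qP_ne hq _
  rw [show L - (NN nn 1 + n) = L - n - NN nn 1 by omega]
  have e : q ^ (2 * (n : ℤ) * (SN nn : ℕ)) = q ^ (2 * n * SN nn) := by
    rw [← zpow_natCast]; push_cast; rfl
  have e2 : (((SN nn + (ν + 1) * n : ℕ)) : ℤ) = (SN nn : ℤ) + ((ν + 1 : ℕ) : ℤ) * n := by push_cast; ring
  rw [e, e2]
  field_simp
  ring

lemma PP_tsum {q : ℂ} (hq : ‖q‖ < 1) (h0 : q ≠ 0) : ∀ (ν s L : ℕ) (φ : ℤ → ℂ),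
    PP q ν s L φ = ∑' nn, trm q ν s L φ nn
  | 0, s, L, φ => by
    rw [tsum_fintype]
    simp [trm, PP, NN, SN, expAG, div_self (qP_ne hq L)]
  | ν + 1, s, L, φ => by
    have hf : Summable (trm q (ν + 1) s L φ) := summable_of_hasFiniteSupport (trm_fin q (ν + 1) s L φ)
    rw [← (Fin.snocEquiv (fun _ => ℕ)).tsum_eq]
    have hf' := (Fin.snocEquiv (fun _ : Fin (ν + 1) => ℕ)).summable_iff.mpr hf
    have hf2 : Summable (fun p : ℕ × (Fin ν → ℕ) => trm q (ν + 1) s L φ (Fin.snoc p.2 p.1)) := hf'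
    show _ = ∑' p : ℕ × (Fin ν → ℕ), trm q (ν + 1) s L φ (Fin.snoc p.2 p.1)
    rw [hf2.tsum_prod, PP_succ, tsum_eq_sum (s := range (L + 1))]
    · refine Finset.sum_congr rfl fun n hn => ?_
      have hn : n ≤ L := by simpa [Nat.lt_succ_iff] using hn
      simp only [trm_snoc hq h0, if_pos hn]
      rw [tsum_mul_left, tsum_mul_left, ← PP_tsum hq h0 ν]
    · intro n hn
      have hn : ¬ n ≤ L := by simpa [Nat.lt_succ_iff] using hn
      simp [trm_snoc hq h0, if_neg hn]
end AGV

namespace AGV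
open Finset Filter Topology

def qinf (q : ℂ) : ℂ := ∏' n : ℕ, (1 - q ^ (n + 1))

lemma qP_tendsto {q : ℂ} (hq : ‖q‖ < 1) : Tendsto (fun n => qP q n) atTop (𝓝 (qinf q)) :=
  (ModularForm.multipliable_one_sub_pow hq).tendsto_prod_tprod_nat

lemma qinf_ne {q : ℂ} (hq : ‖q‖ < 1) : qinf q ≠ 0 := by
  have : (fun n : ℕ => 1 - q ^ (n + 1)) = fun n => 1 + (- q ^ (n + 1)) := by ext; ring
  unfold qinf
  rw [this]
  refine tprod_one_add_ne_zero_of_summable ?_ ?_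
  · intro i
    have := one_sub_ne hq (Nat.succ_ne_zero i)
    rwa [sub_eq_add_neg] at this
  · simpa using (summable_nat_add_iff 1).mpr (summable_geometric_of_lt_one (norm_nonneg _) hq)

lemma qP_bdd {q : ℂ} (hq : ‖q‖ < 1) : ∃ C : ℝ, 1 ≤ C ∧ ∀ n, ‖qP q n‖ ≤ C ∧ ‖(qP q n)⁻¹‖ ≤ C := by
  have h1 := (qP_tendsto hq).norm.bddAbove_range
  have h2 := ((qP_tendsto hq).inv₀ (qinf_ne hq)).norm.bddAbove_range
  obtain ⟨a, ha⟩ := h1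
  obtain ⟨b, hb⟩ := h2
  refine ⟨max 1 (max a b), le_max_left _ _, fun n => ⟨?_, ?_⟩⟩
  · exact (ha ⟨n, rfl⟩).trans ((le_max_left _ _).trans (le_max_right _ _))
  · exact (hb ⟨n, rfl⟩).trans ((le_max_right _ _).trans (le_max_right _ _))

lemma sum_Icc_fin {α : Type*} [AddCommMonoid α] (f : ℕ → α) (ν : ℕ) :
    ∑ i ∈ Icc 1 ν, f i = ∑ i : Fin ν, f (i + 1) := by
  induction ν with
  | zero => simp
  | succ n ih => rw [Finset.sum_Icc_succ_top (by omega), ih, Fin.sum_univ_castSucc]; simp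

lemma exp_bd (ν s c : ℕ) (m : ℤ) (hm : -(c : ℤ) ≤ m) (nn : Fin ν → ℕ) :
    ∑ i, ((nn i : ℤ) - (c + 1) ^ 2) ≤ (expAG ν s nn : ℤ) + m * SN nn := by
  have h1 : (∑ i : Fin ν, ((NN nn (i + 1) : ℤ)) ^ 2) ≤ expAG ν s nn := by
    unfold expAG
    rw [← sum_Icc_fin (fun i => ((NN nn i : ℤ)) ^ 2)]
    push_cast
    have : (0 : ℤ) ≤ ∑ i ∈ Icc (s + 1) ν, (NN nn i : ℤ) := Finset.sum_nonneg fun _ _ => by positivity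
    linarith
  have h2 : (SN nn : ℤ) = ∑ i : Fin ν, (NN nn (i + 1) : ℤ) := by
    rw [← sum_Icc_fin (fun i => ((NN nn i : ℤ)))]
    simp [SN]
  have h3 : ∑ i, ((nn i : ℤ) - (c + 1) ^ 2) ≤
      ∑ i : Fin ν, (((NN nn (i + 1) : ℤ)) ^ 2 + m * (NN nn (i + 1) : ℤ)) := by
    refine Finset.sum_le_sum fun i _ => ?_
    have h4 : (nn i : ℤ) ≤ NN nn (i + 1) := by exact_mod_cast le_NN nn i
    have h5 : (0 : ℤ) ≤ NN nn (i + 1) := by positivity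
    have h6 : (0 : ℤ) ≤ c := by positivity
    nlinarith [sq_nonneg ((NN nn (i + 1) : ℤ) - (c + 1)), mul_nonneg h5 (by linarith : 0 ≤ m + c), mul_nonneg h5 h6]
  rw [Finset.sum_add_distrib, ← Finset.mul_sum, ← h2] at h3
  linarith

lemma norm_bd {q : ℂ} (h0 : q ≠ 0) (hq : ‖q‖ < 1) (ν s c : ℕ) (m : ℤ) (hm : -(c : ℤ) ≤ m)
    (nn : Fin ν → ℕ) : ‖q ^ ((expAG ν s nn : ℤ) + m * SN nn)‖ ≤
      ∏ i, (‖q‖ ^ (-((c : ℤ) + 1) ^ 2) * ‖q‖ ^ nn i) := by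
  rw [norm_zpow]
  have hr : 0 < ‖q‖ := norm_pos_iff.mpr h0
  refine (zpow_le_zpow_right_of_le_one₀ hr hq.le (exp_bd ν s c m hm nn)).trans (le_of_eq ?_)
  have : ∀ (t : Finset (Fin ν)) (f : Fin ν → ℤ), ‖q‖ ^ (∑ i ∈ t, f i) = ∏ i ∈ t, ‖q‖ ^ f i := by
    intro t f
    induction t using Finset.induction_on with
    | empty => simp
    | insert a t ha ih => rw [Finset.sum_insert ha, Finset.prod_insert ha, zpow_add₀ hr.ne', ih]
  rw [this]
  refine Finset.prod_congr rfl fun i _ => ?_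
  rw [← zpow_natCast, ← zpow_add₀ hr.ne', sub_eq_neg_add]

lemma summable_pi {f : ℕ → ℝ} (hf : Summable f) (h : ∀ n, 0 ≤ f n) (ν : ℕ) :
    Summable (fun nn : Fin ν → ℕ => ∏ i, f (nn i)) := by
  induction ν with
  | zero => exact (hasSum_fintype _).summable
  | succ ν IH =>
    have h1 : Summable (fun p : ℕ × (Fin ν → ℕ) => f p.1 * ∏ i, f (p.2 i)) :=
      Summable.mul_of_nonneg (f := f) (g := fun nn : Fin ν → ℕ => ∏ i, f (nn i)) hf IH (Pi.le_def.mpr h)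
        (Pi.le_def.mpr fun _ => Finset.prod_nonneg fun _ _ => h _)
    rw [← (Fin.snocEquiv (fun _ : Fin (ν + 1) => ℕ)).summable_iff]
    refine h1.congr fun p => ?_
    show f p.1 * ∏ i, f (p.2 i) = ∏ i, f ((Fin.snoc p.2 p.1 : Fin (ν + 1) → ℕ) i)
    rw [Fin.prod_univ_castSucc]
    simp [mul_comm]

lemma bound_summable {q : ℂ} (hq : ‖q‖ < 1) (ν c : ℕ) (C D : ℝ) (hC : 0 ≤ C) :
    Summable (fun nn : Fin ν → ℕ => D * ∏ i, (‖q‖ ^ (-((c : ℤ) + 1) ^ 2) * ‖q‖ ^ nn i * C)) := by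
  refine Summable.mul_left D (summable_pi (f := fun n => ‖q‖ ^ (-((c : ℤ) + 1) ^ 2) * ‖q‖ ^ n * C) ?_ ?_ ν)
  · exact ((summable_geometric_of_lt_one (norm_nonneg _) hq).mul_left _).mul_right _
  · intro n; positivity

def sterm (q : ℂ) (ν s : ℕ) (m : ℤ) (nn : Fin ν → ℕ) : ℂ :=
  q ^ ((expAG ν s nn : ℤ) + m * SN nn) / ∏ i, qP q (nn i)

def SS (q : ℂ) (ν s : ℕ) (m : ℤ) : ℂ := ∑' nn : Fin ν → ℕ, sterm q ν s m nn

lemma sterm_bd {q : ℂ} (h0 : q ≠ 0) (hq : ‖q‖ < 1) {C : ℝ} (hC : ∀ n, ‖(qP q n)⁻¹‖ ≤ C)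
    (ν s c : ℕ) (m : ℤ) (hm : -(c : ℤ) ≤ m)
    (nn : Fin ν → ℕ) : ‖sterm q ν s m nn‖ ≤
      ∏ i, (‖q‖ ^ (-((c : ℤ) + 1) ^ 2) * ‖q‖ ^ nn i * C) := by
  unfold sterm
  rw [div_eq_mul_inv, norm_mul, Finset.prod_mul_distrib]
  refine mul_le_mul (norm_bd h0 hq ν s c m hm nn) ?_ (norm_nonneg _)
    (Finset.prod_nonneg fun _ _ => by positivity)
  rw [← Finset.prod_inv_distrib, norm_prod]
  exact Finset.prod_le_prod (fun _ _ => norm_nonneg _) (fun i _ => hC _)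

lemma PP_tendsto {q : ℂ} (h0 : q ≠ 0) (hq : ‖q‖ < 1) (ν s : ℕ) (m : ℤ) :
    Tendsto (fun L => PP q ν s L (fun a => q ^ (m * a))) atTop (𝓝 (SS q ν s m)) := by
  obtain ⟨C, hC1, hC⟩ := qP_bdd hq
  simp_rw [PP_tsum hq h0]
  unfold SS
  refine tendsto_tsum_of_dominated_convergence (bound_summable hq ν m.natAbs C (C * C) (by linarith)) ?_ ?_
  · intro nn
    have h1 : Tendsto (fun L => qP q L / qP q (L - NN nn 1)) atTop (𝓝 (qinf q / qinf q)) :=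
      (qP_tendsto hq).div ((qP_tendsto hq).comp (tendsto_sub_atTop_nat _)) (qinf_ne hq)
    rw [div_self (qinf_ne hq)] at h1
    have h2 := h1.const_mul (sterm q ν s m nn)
    rw [mul_one] at h2
    refine h2.congr' ?_
    filter_upwards [eventually_ge_atTop (NN nn 1)] with L hL
    rw [trm, if_pos hL, sterm, zpow_add₀ h0, zpow_natCast]
    have h3 := qP_ne hq (L - NN nn 1)
    have h5 : ∏ i, qP q (nn i) ≠ 0 := Finset.prod_ne_zero_iff.mpr fun _ _ => qP_ne hq _
    field_simp
  · refine Eventually.of_forall fun L nn => ?_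
    have hb := sterm_bd h0 hq (fun n => (hC n).2) ν s m.natAbs m (by omega) nn
    have hp : 0 ≤ ∏ i, (‖q‖ ^ (-((m.natAbs : ℤ) + 1) ^ 2) * ‖q‖ ^ nn i * C) :=
      (norm_nonneg _).trans hb
    by_cases hL : NN nn 1 ≤ L
    · have e : trm q ν s L (fun a => q ^ (m * a)) nn =
        qP q L * (qP q (L - NN nn 1))⁻¹ * sterm q ν s m nn := by
        rw [trm, if_pos hL, sterm, zpow_add₀ h0, zpow_natCast]
        have h3 := qP_ne hq (L - NN nn 1)
        have h5 : ∏ i, qP q (nn i) ≠ 0 := Finset.prod_ne_zero_iff.mpr fun _ _ => qP_ne hq _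
        field_simp
      rw [e, norm_mul, norm_mul]
      exact mul_le_mul (mul_le_mul (hC _).1 (hC _).2 (norm_nonneg _) (by linarith)) hb
        (norm_nonneg _) (by positivity)
    · rw [trm, if_neg hL]; simp only [norm_zero]
      exact mul_nonneg (by positivity) hp

lemma sh_pow {q : ℂ} (h0 : q ≠ 0) (r : ℕ) (m : ℤ) :
    sh q r (fun a => q ^ (m * a)) = (q ^ ((m + 1) * r)) • (fun a => q ^ ((m + 1) * a)) := by
  ext a
  simp only [sh, Pi.smul_apply, smul_eq_mul, ← zpow_add₀ h0]
  congr 1; ring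

lemma SS_zero {q : ℂ} (h0 : q ≠ 0) (hq : ‖q‖ < 1) (ν : ℕ) (m : ℤ) :
    SS q ν 0 m = SS q ν ν (m + 1) := by
  refine tendsto_nhds_unique (PP_tendsto h0 hq ν 0 m) ?_
  simp_rw [PP_z h0, sh_pow h0, PP_smul]
  simpa using PP_tendsto h0 hq ν ν (m + 1)

lemma SS_succ {q : ℂ} (h0 : q ≠ 0) (hq : ‖q‖ < 1) (ν r t : ℕ) (h : r + 1 + t = ν) (m : ℤ) :
    SS q ν (r + 1) m - SS q ν r m = q ^ ((m + 1) * (r + 1)) * SS q ν t (m + 1) := by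
  refine tendsto_nhds_unique ((PP_tendsto h0 hq ν (r + 1) m).sub (PP_tendsto h0 hq ν r m)) ?_
  simp_rw [(III_IV h0 hq ν).2 r t _ _ h, sh_pow h0, PP_smul]
  have h1 := (PP_tendsto h0 hq ν t (m + 1)).const_mul (q ^ ((m + 1) * (r + 1)))
  have h2 := (PP_tendsto h0 hq ν (t + 1) (m + 1)).const_mul (q ^ ((m + 1) * (r + 1)))
  have h3 := (tendsto_pow_atTop_nhds_zero_of_norm_lt_one hq).mul h2
  simpa using h1.sub h3

lemma SS_rec {q : ℂ} (h0 : q ≠ 0) (hq : ‖q‖ < 1) (ν : ℕ) (m : ℤ) : ∀ s : ℕ, s ≤ ν →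
    SS q ν s m = ∑ t ∈ range (s + 1), q ^ ((m + 1) * t) * SS q ν (ν - t) (m + 1)
  | 0, _ => by simp [SS_zero h0 hq]
  | s + 1, h => by
    rw [Finset.sum_range_succ, ← SS_rec h0 hq ν m s (by omega)]
    have := SS_succ h0 hq ν s (ν - (s + 1)) (by omega) m
    push_cast
    linear_combination this

lemma SS_one {q : ℂ} (h0 : q ≠ 0) (hq : ‖q‖ < 1) (ν s : ℕ) :
    Tendsto (fun m : ℕ => SS q ν s m) atTop (𝓝 1) := by
  obtain ⟨C, hC1, hC⟩ := qP_bdd hq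
  have e : (∑' nn : Fin ν → ℕ, if nn = 0 then (1 : ℂ) else 0) = 1 := tsum_ite_eq _ _
  rw [← e]
  unfold SS
  refine tendsto_tsum_of_dominated_convergence (bound_summable hq ν 0 C 1 (by linarith)) ?_ ?_
  · intro nn
    by_cases h : nn = 0
    · subst h
      have : ∀ m : ℤ, sterm q ν s m 0 = 1 := by
        intro m; simp [sterm, expAG, SN, NN, qP]
      simp [this]
    · rw [if_neg h]
      have hS : SN nn ≠ 0 := by
        intro hS
        apply h
        ext i
        have h1 := le_NN nn i
        rw [SN, sum_Icc_fin, Finset.sum_eq_zero_iff] at hS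
        have := hS i (Finset.mem_univ _)
        simp; omega
      have h2 : ∀ m : ℕ, sterm q ν s m nn = sterm q ν s 0 nn * (q ^ SN nn) ^ m := by
        intro m
        unfold sterm
        rw [zpow_add₀ h0, zpow_add₀ h0, ← pow_mul, ← zpow_natCast q (SN nn * m)]
        simp only [zero_mul, zpow_zero, mul_one]
        push_cast
        rw [mul_comm (m : ℤ)]; ring
      simp_rw [h2]
      have := (tendsto_pow_atTop_nhds_zero_of_norm_lt_one (x := q ^ SN nn)
        (by rw [norm_pow]; exact pow_lt_one₀ (norm_nonneg _) hq hS)).const_mul (sterm q ν s 0 nn)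
      simpa using this
  · refine Eventually.of_forall fun m nn => ?_
    have := sterm_bd h0 hq (fun n => (hC n).2) ν s 0 m (by simp) nn
    rw [one_mul]; exact_mod_cast this
end AGV

namespace AGV
open Finset Filter Topology

lemma summ_aux {q : ℂ} (h0 : q ≠ 0) (hq : ‖q‖ < 1) (E : ℕ → ℤ) (hE : ∀ n : ℕ, (n : ℤ) ≤ E n)
    (c : ℕ → ℂ) (D : ℝ) (hc : ∀ n, ‖c n‖ ≤ D) : Summable (fun n => q ^ E n * c n) := by
  refine Summable.of_norm_bounded
    ((summable_geometric_of_lt_one (norm_nonneg q) hq).mul_right D) fun n => ?_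
  have hr : 0 < ‖q‖ := norm_pos_iff.mpr h0
  rw [norm_mul, norm_zpow]
  refine mul_le_mul ?_ (hc n) (norm_nonneg _) (by positivity)
  rw [← zpow_natCast]
  exact zpow_le_zpow_right_of_le_one₀ hr hq.le (hE n)

def tr (n : ℕ) : ℕ := n * (n + 1) / 2

lemma tr_succ (n : ℕ) : tr (n + 1) = tr n + (n + 1) := by
  unfold tr
  rw [show (n + 1) * (n + 1 + 1) = n * (n + 1) + (n + 1) * 2 by ring,
    Nat.add_mul_div_right _ _ (by norm_num)]

lemma tr_zero : tr 0 = 0 := rfl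

lemma le_tr : ∀ n : ℕ, n ≤ tr n
  | 0 => le_rfl
  | n + 1 => by rw [tr_succ]; omega

/-- coefficient -/
def jc (q : ℂ) (m n : ℕ) : ℂ := (-1) ^ n * (qP q (m + n) / qP q n)

lemma jc_bd {q : ℂ} (hq : ‖q‖ < 1) : ∃ D : ℝ, 0 ≤ D ∧ ∀ m n, ‖jc q m n‖ ≤ D := by
  obtain ⟨C, hC1, hC⟩ := qP_bdd hq
  refine ⟨C * C, by positivity, fun m n => ?_⟩
  unfold jc
  rw [norm_mul, div_eq_mul_inv, norm_mul, norm_pow]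
  simp only [norm_neg, norm_one, one_pow, one_mul]
  exact mul_le_mul (hC _).1 (hC _).2 (norm_nonneg _) (by linarith)

lemma one_sub_bd {q : ℂ} (hq : ‖q‖ < 1) (n : ℕ) : ‖1 - q ^ n‖ ≤ 2 := by
  have := norm_sub_le (1 : ℂ) (q ^ n)
  rw [norm_pow, norm_one] at this
  have h := pow_le_one₀ (n := n) (norm_nonneg q) hq.le
  linarith

def jt (q : ℂ) (ν i m n : ℕ) : ℂ :=
  q ^ ((m : ℤ) * (ν + 1) * n + (2 * ν + 3) * tr n - i * n) *
    ((1 - q ^ (i * (2 * n + 1 + m))) * jc q m n)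

def JJ (q : ℂ) (ν i m : ℕ) : ℂ := ∑' n, jt q ν i m n

lemma jexp (ν i m n : ℕ) (hi : i ≤ ν + 1) :
    (n : ℤ) ≤ (m : ℤ) * (ν + 1) * n + (2 * ν + 3) * tr n - i * n := by
  have h1 : (n : ℤ) ≤ tr n := by exact_mod_cast le_tr n
  have h2 : (i : ℤ) ≤ ν + 1 := by exact_mod_cast hi
  have h3 : (0 : ℤ) ≤ (m : ℤ) * (ν + 1) * n := by positivity
  have h4 : (0 : ℤ) ≤ n := by positivity
  have h5 : (0 : ℤ) ≤ ν := by positivity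
  nlinarith [mul_nonneg h4 (sub_nonneg.mpr h2), mul_nonneg h5 (sub_nonneg.mpr h1), mul_nonneg h4 h5]

lemma jt_summable {q : ℂ} (h0 : q ≠ 0) (hq : ‖q‖ < 1) (ν i m : ℕ) (hi : i ≤ ν + 1) :
    Summable (jt q ν i m) := by
  obtain ⟨D, hD0, hD⟩ := jc_bd hq
  refine summ_aux h0 hq _ (fun n => jexp ν i m n hi) _ (2 * D) fun n => ?_
  rw [norm_mul]
  exact mul_le_mul (one_sub_bd hq _) (hD _ _) (norm_nonneg _) (by norm_num)

lemma JJ_zero (q : ℂ) (ν m : ℕ) : JJ q ν 0 m = 0 := by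
  simp [JJ, jt]

lemma jc_succ1 {q : ℂ} (hq : ‖q‖ < 1) (m n : ℕ) :
    jc q m (n + 1) * (1 - q ^ (n + 1)) = - jc q (m + 1) n := by
  unfold jc
  rw [qP_succ q n, show m + (n + 1) = m + 1 + n by ring]
  have h1 := qP_ne hq n
  have h2 := one_sub_ne hq (Nat.succ_ne_zero n)
  rw [Nat.succ_eq_add_one] at h2
  field_simp
  ring

lemma jc_succ2 (q : ℂ) (m n : ℕ) :
    jc q m n * (1 - q ^ (m + n + 1)) = jc q (m + 1) n := by
  unfold jc
  rw [show m + 1 + n = m + n + 1 by ring, qP_succ]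
  ring

lemma JJ_diff {q : ℂ} (h0 : q ≠ 0) (hq : ‖q‖ < 1) (ν i m : ℕ) (hi : i ≤ ν) :
    JJ q ν (i + 1) m - JJ q ν i m = q ^ (((m : ℤ) + 1) * i) * JJ q ν (ν + 1 - i) (m + 1) := by
  obtain ⟨D, hD0, hD⟩ := jc_bd hq
  let P1 : ℕ → ℂ := fun n => q ^ ((m : ℤ) * (ν + 1) * n + (2 * ν + 3) * tr n - (i + 1 : ℕ) * n) *
    ((1 - q ^ n) * jc q m n)
  let P2 : ℕ → ℂ := fun n => q ^ ((m : ℤ) * (ν + 1) * n + (2 * ν + 3) * tr n + i * (n + 1 + m)) *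
    ((1 - q ^ (m + n + 1)) * jc q m n)
  have s1 : Summable P1 := by
    refine summ_aux h0 hq _ (fun n => jexp ν (i + 1) m n (by omega)) _ (2 * D) fun n => ?_
    rw [norm_mul]
    exact mul_le_mul (one_sub_bd hq _) (hD _ _) (norm_nonneg _) (by norm_num)
  have s2 : Summable P2 := by
    refine summ_aux h0 hq _ (fun n => ?_) _ (2 * D) fun n => ?_
    · have := jexp ν 0 m n (by omega)
      have h3 : (0 : ℤ) ≤ (i : ℤ) * (n + 1 + m) := by positivity
      simp only [Nat.cast_zero, zero_mul, sub_zero] at this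
      linarith
    rw [norm_mul]
    exact mul_le_mul (one_sub_bd hq _) (hD _ _) (norm_nonneg _) (by norm_num)
  have e1 : JJ q ν (i + 1) m - JJ q ν i m = ∑' n, P1 n + ∑' n, P2 n := by
    unfold JJ
    rw [← (jt_summable h0 hq ν (i + 1) m (by omega)).tsum_sub (jt_summable h0 hq ν i m (by omega)),
      ← s1.tsum_add s2]
    refine tsum_congr fun n => ?_
    simp only [jt, P1, P2]
    have a : ∀ x y z w v u: ℂ, x * ((1 - y) * jc q m n) - z * ((1 - w) * jc q m n) =
      (x - x * y - z + z * w) * jc q m n := by intros; ring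
    rw [a (v := 0) (u := 0)]
    have b : ∀ x y z w v u: ℂ, x * ((1 - y) * jc q m n) + z * ((1 - w) * jc q m n) =
      (x - x * y + z - z * w) * jc q m n := by intros; ring
    rw [b (v := 0) (u := 0)]
    congr 1
    simp only [← zpow_natCast, ← zpow_add₀ h0]
    have c1 : (m : ℤ) * (ν + 1) * n + (2 * ν + 3) * tr n - (i + 1 : ℕ) * n +
      (((i + 1) * (2 * n + 1 + m) : ℕ) : ℤ) =
      (m : ℤ) * (ν + 1) * n + (2 * ν + 3) * tr n + i * (n + 1 + m) + ((m + n + 1 : ℕ) : ℤ) := by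
      push_cast; ring
    have c2 : (m : ℤ) * (ν + 1) * n + (2 * ν + 3) * tr n - (i : ℕ) * n +
      (((i) * (2 * n + 1 + m) : ℕ) : ℤ) =
      (m : ℤ) * (ν + 1) * n + (2 * ν + 3) * tr n + i * (n + 1 + m)  := by
      push_cast; ring
    have c3 : (m : ℤ) * (ν + 1) * n + (2 * ν + 3) * tr n - (i + 1 : ℕ) * n + n =
      (m : ℤ) * (ν + 1) * n + (2 * ν + 3) * tr n - (i : ℕ) * n := by
      push_cast; ring
    rw [c1, c2, c3]; ring
  have e2 : ∑' n, P1 n = ∑' n, P1 (n + 1) := by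
    rw [s1.tsum_eq_zero_add]; simp [P1]
  rw [e1, e2, ← ((summable_nat_add_iff 1).mpr s1).tsum_add s2]
  unfold JJ
  rw [← tsum_mul_left]
  refine tsum_congr fun n => ?_
  simp only [jt, P1, P2]
  rw [mul_comm (1 - q ^ (n + 1)), jc_succ1 hq, mul_comm (1 - q ^ (m + n + 1)), jc_succ2]
  have a : ∀ x y z w : ℂ, x * -jc q (m + 1) n + y * jc q (m + 1) n = (y - x) * jc q (m + 1) n := by
    intros; ring
  rw [a (z := 0) (w := 0), ← mul_assoc, ← mul_assoc]
  congr 1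
  rw [← zpow_add₀ h0, mul_sub, mul_one, ← zpow_natCast q ((ν + 1 - i) * _), ← zpow_add₀ h0, tr_succ]
  push_cast [Nat.cast_sub (show i ≤ ν + 1 by omega)]
  congr 2 <;> ring

lemma JJ_rec {q : ℂ} (h0 : q ≠ 0) (hq : ‖q‖ < 1) (ν m : ℕ) : ∀ s : ℕ, s ≤ ν →
    JJ q ν (s + 1) m = ∑ t ∈ range (s + 1), q ^ (((m : ℤ) + 1) * t) * JJ q ν (ν - t + 1) (m + 1)
  | 0, _ => by
    have := JJ_diff h0 hq ν 0 m (by omega)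
    rw [JJ_zero] at this
    simpa using this
  | s + 1, h => by
    rw [Finset.sum_range_succ, ← JJ_rec h0 hq ν m s (by omega)]
    have := JJ_diff h0 hq ν (s + 1) m (by omega)
    rw [show ν - (s + 1) + 1 = ν + 1 - (s + 1) by omega]
    linear_combination this

lemma JJ_lim {q : ℂ} (h0 : q ≠ 0) (hq : ‖q‖ < 1) (ν i : ℕ) (hi : i + 1 ≤ ν + 1) :
    Tendsto (fun m : ℕ => JJ q ν (i + 1) m) atTop (𝓝 (qinf q)) := by
  obtain ⟨D, hD0, hD⟩ := jc_bd hq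
  have hr : 0 < ‖q‖ := norm_pos_iff.mpr h0
  have e : (∑' n : ℕ, if n = 0 then qinf q else 0) = qinf q := tsum_ite_eq _ _
  rw [← e]
  unfold JJ
  have hcb : ∀ m n, ‖(1 - q ^ ((i + 1) * (2 * n + 1 + m))) * jc q m n‖ ≤ 2 * D := by
    intro m n
    rw [norm_mul]
    exact mul_le_mul (one_sub_bd hq _) (hD _ _) (norm_nonneg _) (by norm_num)
  refine tendsto_tsum_of_dominated_convergence
    ((summable_geometric_of_lt_one (norm_nonneg q) hq).mul_right (2 * D)) ?_ ?_
  · intro n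
    by_cases h : n = 0
    · subst h
      simp only [jt, jc, tr_zero, if_true, mul_zero, zero_add, add_zero, Nat.cast_zero, sub_zero, zpow_zero, one_mul, pow_zero, qP_zero, div_one]
      have h1 : Tendsto (fun m : ℕ => q ^ ((i + 1) * (1 + m))) atTop (𝓝 0) := by
        refine (tendsto_pow_atTop_nhds_zero_of_norm_lt_one hq).comp ?_
        refine tendsto_atTop_mono (fun m => ?_) tendsto_id
        simp only [id]; nlinarith
      simpa using (h1.const_sub 1).mul (qP_tendsto hq)
    · rw [if_neg h]
      refine squeeze_zero_norm (a := fun m : ℕ => ‖q‖ ^ m * (2 * D)) (fun m => ?_) ?_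
      · unfold jt
        rw [norm_mul, norm_zpow]
        refine mul_le_mul ?_ (hcb m n) (norm_nonneg _) (by positivity)
        rw [← zpow_natCast]
        apply zpow_le_zpow_right_of_le_one₀ hr hq.le
        have := jexp ν (i + 1) 0 n hi
        have h2 : (1 : ℤ) ≤ n := by omega
        have h3 : (0 : ℤ) ≤ m := by positivity
        have h5 : (0 : ℤ) ≤ ν := by positivity
        have h6 : (m : ℤ) ≤ (m : ℤ) * (ν + 1) * n := by
          have : (m : ℤ) * 1 ≤ m * ((ν + 1) * n) :=
            mul_le_mul_of_nonneg_left (by nlinarith) h3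
          linarith
        simp only [Nat.cast_zero, zero_mul, zero_add] at this
        linarith
      · simpa using (tendsto_pow_atTop_nhds_zero_of_lt_one (norm_nonneg q) hq).mul_const (2 * D)
  · refine Eventually.of_forall fun m n => ?_
    unfold jt
    rw [norm_mul, norm_zpow]
    refine mul_le_mul ?_ (hcb m n) (norm_nonneg _) (by positivity)
    rw [← zpow_natCast]
    exact zpow_le_zpow_right_of_le_one₀ hr hq.le (jexp ν (i + 1) m n hi)

lemma uniq {r : ℝ} (hr0 : 0 ≤ r) (hr : r < 1) (ν : ℕ) (D : ℕ → ℕ → ℂ) (q : ℂ) (hqr : ‖q‖ = r)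
    (hrec : ∀ s m, s ≤ ν → D s m = ∑ t ∈ range (s + 1), q ^ ((m + 1) * t) * D (ν - t) (m + 1))
    (hlim : ∀ s, s ≤ ν → Tendsto (D s) atTop (𝓝 0)) : ∀ s m, s ≤ ν → D s m = 0 := by
  have step : ∀ m (ε : ℝ), 0 ≤ ε → (∀ s ≤ ν, ‖D s (m + 1)‖ ≤ ε) →
      ∀ s ≤ ν, ‖D s m‖ ≤ ε * (1 + ν * r ^ (m + 1)) := by
    intro m ε hε h s hs
    rw [hrec s m hs]
    refine (norm_sum_le _ _).trans ?_
    have h1 : ∀ t ∈ range (s + 1), ‖q ^ ((m + 1) * t) * D (ν - t) (m + 1)‖ ≤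
        r ^ ((m + 1) * t) * ε := by
      intro t _
      rw [norm_mul, norm_pow, hqr]
      exact mul_le_mul_of_nonneg_left (h _ (by omega)) (by positivity)
    refine (Finset.sum_le_sum h1).trans ?_
    rw [Finset.sum_range_succ', ← Finset.sum_mul]
    have h2 : ∑ t ∈ range s, r ^ ((m + 1) * (t + 1)) ≤ ∑ t ∈ range s, r ^ (m + 1) := by
      refine Finset.sum_le_sum fun t _ => ?_
      exact pow_le_pow_of_le_one hr0 hr.le (by nlinarith)
    rw [Finset.sum_const, Finset.card_range, nsmul_eq_mul] at h2
    have h3 : (s : ℝ) * r ^ (m + 1) ≤ ν * r ^ (m + 1) :=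
      mul_le_mul_of_nonneg_right (by exact_mod_cast hs) (by positivity)
    simp only [mul_zero, pow_zero, one_mul]
    nlinarith [mul_le_mul_of_nonneg_right (h2.trans h3) hε]
  have iter : ∀ n m (ε : ℝ), 0 ≤ ε → (∀ s ≤ ν, ‖D s (m + n)‖ ≤ ε) →
      ∀ s ≤ ν, ‖D s m‖ ≤ ε * Real.exp (∑ j ∈ range n, ν * r ^ j) := by
    intro n
    induction n with
    | zero => intro m ε _ h s hs; simpa using h s hs
    | succ n ih =>
      intro m ε hε h s hs
      have h1 := step (m + n) ε hε (by simpa [add_assoc] using h)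
      have h2 := ih m _ (by positivity) h1 s hs
      refine h2.trans ?_
      rw [Finset.sum_range_succ, Real.exp_add, mul_assoc, mul_comm (Real.exp _)]
      refine mul_le_mul_of_nonneg_left ?_ hε
      refine mul_le_mul_of_nonneg_right ?_ (Real.exp_nonneg _)
      have h3 := Real.add_one_le_exp ((ν : ℝ) * r ^ n)
      have h4 : r ^ (m + n + 1) ≤ r ^ n := pow_le_pow_of_le_one hr0 hr.le (by omega)
      have h5 : (ν : ℝ) * r ^ (m + n + 1) ≤ ν * r ^ n := mul_le_mul_of_nonneg_left h4 (by positivity)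
      linarith
  intro s m hs
  set E := Real.exp (∑' j : ℕ, ν * r ^ j) with hE
  have hsum : Summable (fun j : ℕ => (ν : ℝ) * r ^ j) := (summable_geometric_of_lt_one hr0 hr).mul_left _
  rw [← norm_eq_zero]
  refine le_antisymm (le_of_forall_pos_le_add fun δ hδ => ?_) (norm_nonneg _)
  have hEp : 0 < E := Real.exp_pos _
  have hev : ∀ᶠ n in atTop, ∀ s ∈ range (ν + 1), ‖D s n‖ ≤ δ / E := by
    rw [Filter.eventually_all_finset]
    intro s hs
    have := (hlim s (by simpa [Nat.lt_succ_iff] using hs)).norm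
    rw [norm_zero] at this
    exact (this.eventually (gt_mem_nhds (by positivity : 0 < δ / E))).mono fun _ h => le_of_lt h
  obtain ⟨n, hn⟩ := hev.exists_forall_of_atTop
  have h1 := iter n m (δ / E) (by positivity) (fun s hs => hn (m + n) (by omega) s (by simp; omega)) s hs
  refine h1.trans ?_
  have h2 : Real.exp (∑ j ∈ range n, (ν : ℝ) * r ^ j) ≤ E :=
    Real.exp_le_exp.mpr (hsum.sum_le_tsum _ fun _ _ => by positivity)
  rw [zero_add]
  calc δ / E * Real.exp (∑ j ∈ range n, (ν : ℝ) * r ^ j) ≤ δ / E * E :=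
      mul_le_mul_of_nonneg_left h2 (by positivity)
    _ = δ := div_mul_cancel₀ _ hEp.ne'

lemma SS_JJ {q : ℂ} (h0 : q ≠ 0) (hq : ‖q‖ < 1) (ν s m : ℕ) (hs : s ≤ ν) :
    qinf q * SS q ν s m = JJ q ν (s + 1) m := by
  have := uniq (norm_nonneg q) hq ν (fun s m => qinf q * SS q ν s m - JJ q ν (s + 1) m) q rfl ?_ ?_ s m hs
  · exact sub_eq_zero.mp this
  · intro s m hs
    rw [SS_rec h0 hq ν m s hs, JJ_rec h0 hq ν m s hs, Finset.mul_sum, ← Finset.sum_sub_distrib]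
    refine Finset.sum_congr rfl fun t _ => ?_
    have : q ^ (((m : ℤ) + 1) * t) = q ^ ((m + 1) * t) := by
      rw [← zpow_natCast]; push_cast; rfl
    rw [this]; push_cast; ring
  · intro s hs
    simpa using ((SS_one h0 hq ν s).const_mul (qinf q)).sub (JJ_lim h0 hq ν s (by omega))

lemma tr_int (n : ℕ) : (n : ℤ) * (n + 1) / 2 = tr n := by
  unfold tr; push_cast; rfl

lemma JJ_Th {q : ℂ} (h0 : q ≠ 0) (hq : ‖q‖ < 1) (ν i : ℕ) (hi : i ≤ ν + 1) :
    JJ q ν i 0 = Th q (2 * ν + 3) (-i) := by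
  unfold Th
  have hb : ∀ n : ℕ, ‖(-1 : ℂ) ^ n‖ ≤ 1 := fun n => by simp
  have e1 : ∀ n : ℕ, (-1 : ℂ) ^ (n : ℤ) * q ^ ((2 * (ν : ℤ) + 3) * ((n : ℤ) * (n + 1) / 2) + n * (-(i : ℤ))) =
      q ^ ((2 * (ν : ℤ) + 3) * tr n - i * n) * (-1) ^ n := by
    intro n
    rw [tr_int, zpow_natCast, mul_comm]; congr 2; ring
  have e2 : ∀ n : ℕ, (-1 : ℂ) ^ (-((n : ℤ) + 1)) *
        q ^ ((2 * (ν : ℤ) + 3) * ((-((n : ℤ) + 1)) * (-((n : ℤ) + 1) + 1) / 2) + (-((n : ℤ) + 1)) * (-(i : ℤ))) =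
      q ^ ((2 * (ν : ℤ) + 3) * tr n + i * (n + 1)) * -(-1) ^ n := by
    intro n
    rw [show (-((n : ℤ) + 1)) * (-((n : ℤ) + 1) + 1) = n * (n + 1) by ring, tr_int, mul_comm]
    congr 1
    · congr 1; ring
    · rw [show -((n : ℤ) + 1) = -((n + 1 : ℕ) : ℤ) by push_cast; ring, zpow_neg, zpow_natCast]
      rcases Nat.even_or_odd n with h | h <;> simp [h.neg_one_pow, pow_succ]
  have s1 : Summable fun n : ℕ => q ^ ((2 * (ν : ℤ) + 3) * tr n - i * n) * (-1) ^ n := by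
    refine summ_aux h0 hq _ (fun n => ?_) _ 1 hb
    simpa using jexp ν i 0 n hi
  have s2 : Summable fun n : ℕ => q ^ ((2 * (ν : ℤ) + 3) * tr n + i * (n + 1)) * -(-1) ^ n := by
    refine summ_aux h0 hq _ (fun n => ?_) _ 1 (by simpa using hb)
    have := jexp ν 0 0 n (by omega)
    simp at this
    have : (0 : ℤ) ≤ i * (n + 1) := by positivity
    linarith
  rw [tsum_of_nat_of_neg_add_one (by simp_rw [e1]; exact s1) (by simp_rw [e2]; exact s2)]
  simp_rw [e1, e2]
  rw [← s1.tsum_add s2]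
  unfold JJ
  refine tsum_congr fun n => ?_
  simp only [jt, jc, zero_add, div_self (qP_ne hq n), Nat.cast_zero, zero_mul, add_zero]
  have : q ^ ((2 * (ν : ℤ) + 3) * tr n + i * (n + 1)) =
    q ^ ((2 * (ν : ℤ) + 3) * tr n - i * n) * q ^ (i * (2 * n + 1)) := by
    rw [← zpow_natCast q (i * _), ← zpow_add₀ h0]; congr 1; push_cast; ring
  rw [this]; ring

lemma SS_Xi {q : ℂ} (h0 : q ≠ 0) (hq : ‖q‖ < 1) (ν : ℕ) : ∀ (M s : ℕ), s ≤ ν →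
    qinf q * SS q ν s (-(M : ℤ)) = Xi q ν (Th q (2 * ν + 3)) M (ν - s)
  | 0, s, hs => by
    have := SS_JJ h0 hq ν s 0 hs
    rw [JJ_Th h0 hq ν _ (by omega)] at this
    rw [Xi_zero]
    push_cast [Nat.cast_sub hs] at this ⊢
    rw [neg_zero, this]
    congr 1; ring
  | M + 1, s, hs => by
    rw [Xi_rec h0 hq ν M _ (fun A => Th1 q _ A) (fun A => Th2 h0 _ A) _ (by omega), SS_rec h0 hq _ _ _ hs,
      Finset.mul_sum, show ν - (ν - s) + 1 = s + 1 by omega]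
    refine Finset.sum_congr rfl fun t ht => ?_
    have ht : t ≤ s := by simpa [Nat.lt_succ_iff] using ht
    have IH := SS_Xi h0 hq ν M (ν - t) (by omega)
    rw [show ν - (ν - t) = t by omega] at IH
    rw [← IH]
    push_cast
    rw [show -((M : ℤ) + 1) + 1 = -M by ring]
    ring
end AGV

namespace AGV
open Finset Filter Topology

def cb (Q : ℂ) (n j : ℕ) : ℂ := if j ≤ n then (-1) ^ j * Q ^ tr j * qb Q n j else 0

lemma cb_zero {Q : ℂ} (hQ : ‖Q‖ < 1) (n : ℕ) : cb Q n 0 = 1 := by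
  simp [cb, qb, qP_zero, tr_zero, div_self (qP_ne hQ n)]

lemma cb_succ {Q : ℂ} (hQ : ‖Q‖ < 1) (n j : ℕ) :
    cb Q (n + 1) (j + 1) = cb Q n (j + 1) - Q ^ (n + 1) * cb Q n j := by
  unfold cb
  rcases lt_trichotomy j n with h | h | h
  · obtain ⟨d, rfl⟩ := Nat.exists_eq_add_of_lt h
    rw [if_pos (by omega), if_pos (by omega), if_pos (by omega), tr_succ]
    unfold qb
    rw [show j + d + 1 + 1 - (j + 1) = d + 1 by omega, show j + d + 1 - (j + 1) = d by omega,
      show j + d + 1 - j = d + 1 by omega, qP_succ Q (j + d + 1), qP_succ Q d, qP_succ Q j]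
    have h1 := qP_ne hQ d
    have h2 := qP_ne hQ j
    have h3 := one_sub_ne hQ (Nat.succ_ne_zero d)
    have h4 := one_sub_ne hQ (Nat.succ_ne_zero j)
    rw [Nat.succ_eq_add_one] at h3 h4
    field_simp
    ring
  · subst h
    rw [if_pos (by omega), if_neg (by omega), if_pos (by omega), tr_succ]
    have h1 := qP_ne hQ j
    have h2 := qP_ne hQ (j + 1)
    simp only [qb, Nat.sub_self, qP_zero, mul_one, div_self h1, div_self h2]
    ring
  · rw [if_neg (by omega), if_neg (by omega), if_neg (by omega)]; simp

lemma qbinom {Q : ℂ} (hQ : ‖Q‖ < 1) (y : ℂ) (n : ℕ) :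
    ∏ i ∈ range n, (1 - y * Q ^ (i + 1)) = ∑ j ∈ range (n + 1), cb Q n j * y ^ j := by
  induction n with
  | zero => simp [cb_zero hQ]
  | succ n ih =>
    rw [Finset.prod_range_succ, ih, Finset.sum_range_succ' _ (n + 1)]
    simp_rw [cb_succ hQ, sub_mul]
    rw [Finset.sum_sub_distrib, cb_zero hQ]
    have h1 : ∑ j ∈ range (n + 1), cb Q n j * y ^ j =
      ∑ j ∈ range (n + 1), cb Q n (j + 1) * y ^ (j + 1) + 1 := by
      have := Finset.sum_range_succ (fun j => cb Q n j * y ^ j) (n + 1)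
      rw [Finset.sum_range_succ' _ (n + 1), cb_zero hQ] at this
      have h2 : cb Q n (n + 1) = 0 := by simp [cb]
      rw [h2] at this
      linear_combination -this
    have h3 : ∑ j ∈ range (n + 1), Q ^ (n + 1) * cb Q n j * y ^ (j + 1) =
       y * Q ^ (n + 1) * ∑ j ∈ range (n + 1), cb Q n j * y ^ j := by
      rw [Finset.mul_sum]
      refine Finset.sum_congr rfl fun j _ => by ring
    rw [h3]
    linear_combination h1

/-- arithmetic-progression product -/
def Ap (q : ℂ) (k c N : ℕ) : ℂ := ∏ i ∈ range N, (1 - q ^ (k * i + c))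

lemma two_tri (n : ℤ) : 2 * (n * (n + 1) / 2) = n * (n + 1) :=
  Int.two_mul_ediv_two_of_even (Int.even_mul_succ_self n)

lemma two_tr (n : ℕ) : 2 * (tr n : ℤ) = (n : ℤ) * (n + 1) := by
  rw [← tr_int, two_tri]

/-- finite Jacobi term -/
def gN (q : ℂ) (k s N : ℕ) (n : ℤ) : ℂ :=
  (-1) ^ n * q ^ ((k : ℤ) * (n * (n + 1) / 2) + n * (-(s : ℤ))) *
    (qP (q ^ k) (2 * N) / (qP (q ^ k) (N + n).toNat * qP (q ^ k) (N - n).toNat))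

lemma norm_pow_lt {q : ℂ} (hq : ‖q‖ < 1) {k : ℕ} (hk : k ≠ 0) : ‖q ^ k‖ < 1 := by
  rw [norm_pow]; exact pow_lt_one₀ (norm_nonneg _) hq hk

lemma finJTP {q : ℂ} (h0 : q ≠ 0) (hq : ‖q‖ < 1) (k s N : ℕ) (hs : s < k) :
    Ap q k s N * Ap q k (k - s) N = ∑ n ∈ Icc (-(N : ℤ)) N, gN q k s N n := by
  have hQ := norm_pow_lt hq (show k ≠ 0 by omega)
  set y : ℂ := q ^ ((s : ℤ) - k * (N + 1)) with hy
  have hb := qbinom hQ y (2 * N)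
  rw [two_mul, Finset.prod_range_add, ← two_mul] at hb
  have e1 : ∏ x ∈ range N, (1 - y * (q ^ k) ^ (N + x + 1)) = Ap q k s N := by
    refine Finset.prod_congr rfl fun i _ => ?_
    rw [hy, ← pow_mul, ← zpow_natCast, ← zpow_natCast, ← zpow_add₀ h0]
    congr 2; push_cast; ring
  have e2 : ∀ M : ℕ, ∏ i ∈ range M, (1 - q ^ ((s : ℤ) - k * (i + 1))) =
      (-1) ^ M * q ^ ((s : ℤ) * M - k * tr M) * Ap q k (k - s) M := by
    intro M
    induction M with
    | zero => simp [Ap, tr_zero]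
    | succ M ih =>
      have : Ap q k (k - s) (M + 1) = Ap q k (k - s) M * (1 - q ^ (k * M + (k - s))) :=
        Finset.prod_range_succ _ _
      rw [Finset.prod_range_succ, ih, this, tr_succ]
      have h1 : q ^ ((s : ℤ) * (M + 1 : ℕ) - k * (tr M + (M + 1) : ℕ)) =
        q ^ ((s : ℤ) * M - k * tr M) * q ^ ((s : ℤ) - k * (M + 1)) := by
        rw [← zpow_add₀ h0]; congr 1; push_cast; ring
      have h2 : q ^ ((s : ℤ) - k * (M + 1)) * q ^ (k * M + (k - s)) = 1 := by
        rw [← zpow_natCast q (k * M + _), ← zpow_add₀ h0]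
        push_cast [Nat.cast_sub hs.le]
        rw [show (s : ℤ) - k * (M + 1) + (k * M + (k - s)) = 0 by ring, zpow_zero]
      rw [h1, pow_succ]
      linear_combination (-(-1) ^ M * q ^ ((s : ℤ) * M - k * tr M) * Ap q k (k - s) M) * h2
  have e3 : ∏ x ∈ range N, (1 - y * (q ^ k) ^ (x + 1)) =
      ∏ i ∈ range N, (1 - q ^ ((s : ℤ) - k * (i + 1))) := by
    rw [← Finset.prod_range_reflect]
    refine Finset.prod_congr rfl fun i hi => ?_
    have hi := Finset.mem_range.mp hi
    rw [hy, ← pow_mul, ← zpow_natCast, ← zpow_add₀ h0]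
    congr 2
    rw [show N - 1 - i + 1 = N - i by omega]
    push_cast [Nat.cast_sub hi.le]; ring
  rw [e1, e3, e2] at hb
  set u : ℂ := (-1) ^ N * q ^ ((s : ℤ) * N - k * tr N) with hu
  have hu0 : u ≠ 0 := mul_ne_zero (pow_ne_zero _ (by norm_num)) (zpow_ne_zero _ h0)
  apply mul_left_cancel₀ hu0
  have e4 : u * (Ap q k s N * Ap q k (k - s) N) = u * Ap q k (k - s) N * Ap q k s N := by ring
  rw [e4, hb, Finset.mul_sum]
  refine Finset.sum_nbij' (fun j : ℕ => (N : ℤ) - j) (fun n : ℤ => (N - n).toNat) ?_ ?_ ?_ ?_ ?_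
  · intro j hj; simp at hj ⊢; omega
  · intro n hn; simp at hn ⊢; omega
  · intro j hj; simp
  · intro n hn; simp at hn ⊢; omega
  · intro j hj
    have hj : j ≤ 2 * N := by simpa [Nat.lt_succ_iff] using hj
    rw [cb, if_pos hj, gN, qb]
    rw [show ((N : ℤ) + (N - j)).toNat = 2 * N - j by omega,
      show ((N : ℤ) - (N - j)).toNat = j by omega]
    have t1 := two_tri ((N : ℤ) - j)
    have t2 := two_tr N
    have t3 := two_tr j
    set X : ℤ := ((N : ℤ) - j) * ((N : ℤ) - j + 1) / 2
    have hX : X = tr j - (N + 1) * j + tr N := by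
      have : 2 * X = 2 * (tr j - (N + 1) * j + tr N) := by rw [t1]; linear_combination -t2 - t3
      omega
    have h3 : (-1 : ℂ) ^ N * (-1) ^ ((N : ℤ) - j) = (-1) ^ j := by
      rw [zpow_sub₀ (by norm_num), zpow_natCast, zpow_natCast]
      rcases Nat.even_or_odd N with h | h <;> rcases Nat.even_or_odd j with h' | h' <;>
        simp [h.neg_one_pow, h'.neg_one_pow]
    have h4 : q ^ ((s : ℤ) * N - k * tr N) * q ^ ((k : ℤ) * X + ((N : ℤ) - j) * (-(s : ℤ))) =
        (q ^ k) ^ tr j * y ^ j := by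
      rw [hy, ← pow_mul, ← zpow_natCast, ← zpow_natCast, ← zpow_mul, ← zpow_add₀ h0, ← zpow_add₀ h0, hX]
      congr 1; push_cast; ring
    rw [hu, mul_comm (qP _ (2 * N - j))]
    linear_combination (-(q ^ ((s : ℤ) * N - k * tr N) * q ^ ((k : ℤ) * X + ((N : ℤ) - j) * (-(s : ℤ))) *
      (qP (q ^ k) (2 * N) / (qP (q ^ k) j * qP (q ^ k) (2 * N - j))))) * h3 -
      ((-1) ^ j * (qP (q ^ k) (2 * N) / (qP (q ^ k) j * qP (q ^ k) (2 * N - j)))) * h4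

lemma th_exp (k s : ℕ) (hs1 : 1 ≤ s) (hs : s < k) (n : ℤ) :
    (n.natAbs : ℤ) ≤ (k : ℤ) * (n * (n + 1) / 2) + n * (-(s : ℤ)) := by
  have t := two_tri n
  set X := n * (n + 1) / 2
  have hs1' : (1 : ℤ) ≤ s := by exact_mod_cast hs1
  have hs' : (s : ℤ) + 1 ≤ k := by exact_mod_cast hs
  have hX0 : 0 ≤ X := by
    rcases le_or_gt 0 n with h | h <;> nlinarith
  rcases le_or_gt 0 n with h | h
  · have hX : n ≤ X := by nlinarith
    rw [Int.natAbs_of_nonneg h]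
    nlinarith [mul_le_mul_of_nonneg_left hX (by linarith : (0 : ℤ) ≤ k), mul_nonneg h (by linarith : (0 : ℤ) ≤ k - s - 1)]
  · rw [Int.ofNat_natAbs_of_nonpos h.le]
    nlinarith [mul_nonneg hX0 (by linarith : (0 : ℤ) ≤ k)]

lemma summ_natAbs {r : ℝ} (h0 : 0 ≤ r) (h1 : r < 1) : Summable (fun n : ℤ => r ^ n.natAbs) := by
  refine Summable.of_nat_of_neg_add_one ?_ ?_
  · simpa using summable_geometric_of_lt_one h0 h1
  · have : ∀ n : ℕ, (-((n : ℤ) + 1)).natAbs = n + 1 := fun n => by omega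
    simp_rw [this]
    exact (summable_nat_add_iff 1).mpr (summable_geometric_of_lt_one h0 h1)

lemma prodS {q : ℂ} (hq : ‖q‖ < 1) (k c : ℕ) (hk : k ≠ 0) :
    Multipliable (fun i : ℕ => 1 - q ^ (k * i + c)) := by
  have : (fun n : ℕ => 1 - q ^ (k * n + c)) = fun n => 1 + (- q ^ (k * n + c)) := by ext; ring
  rw [this]
  apply multipliable_one_add_of_summable
  refine Summable.of_nonneg_of_le (fun _ => norm_nonneg _) (fun n => ?_) (summable_geometric_of_lt_one (norm_nonneg _) hq)
  rw [norm_neg, norm_pow]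
  refine pow_le_pow_of_le_one (norm_nonneg _) hq.le ?_
  have : 1 * n ≤ k * n := Nat.mul_le_mul_right _ (by omega)
  omega

lemma JTP {q : ℂ} (h0 : q ≠ 0) (hq : ‖q‖ < 1) (k s : ℕ) (hs1 : 1 ≤ s) (hs : s < k) :
    (∏' i : ℕ, (1 - q ^ (k * i + s))) * (∏' i : ℕ, (1 - q ^ (k * i + (k - s)))) *
      (∏' i : ℕ, (1 - q ^ (k * i + k))) = Th q k (-(s : ℤ)) := by
  have hk : k ≠ 0 := by omega
  have hQ := norm_pow_lt hq hk
  have hr : 0 < ‖q‖ := norm_pos_iff.mpr h0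
  have e3 : (∏' i : ℕ, (1 - q ^ (k * i + k))) = qinf (q ^ k) := by
    unfold qinf; refine tprod_congr fun i => ?_
    rw [← pow_mul]; congr 2
  have l1 := (prodS hq k s hk).tendsto_prod_tprod_nat
  have l2 := (prodS hq k (k - s) hk).tendsto_prod_tprod_nat
  have l := l1.mul l2
  have hl : Tendsto (fun N : ℕ => Ap q k s N * Ap q k (k - s) N) atTop
    (𝓝 (∑' n : ℤ, (-1) ^ n * q ^ ((k : ℤ) * (n * (n + 1) / 2) + n * (-(s : ℤ))) * (qinf (q ^ k))⁻¹)) := by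
    have e : ∀ N : ℕ, Ap q k s N * Ap q k (k - s) N =
      ∑' n : ℤ, if n ∈ Icc (-(N : ℤ)) N then gN q k s N n else 0 := by
      intro N
      rw [finJTP h0 hq k s N hs, tsum_eq_sum (s := Icc (-(N : ℤ)) N)]
      · exact Finset.sum_congr rfl fun n hn => by rw [if_pos hn]
      · intro n hn; rw [if_neg hn]
    simp_rw [e]
    obtain ⟨C, hC1, hC⟩ := qP_bdd hQ
    refine tendsto_tsum_of_dominated_convergence
      ((summ_natAbs (norm_nonneg q) hq).mul_right (C * (C * C))) ?_ ?_
    · intro n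
      have a0 : Tendsto (fun N : ℕ => qP (q ^ k) (2 * N)) atTop (𝓝 (qinf (q ^ k))) :=
        (qP_tendsto hQ).comp (tendsto_atTop_mono (fun N => by simp only [id]; omega) tendsto_id)
      have a1 : Tendsto (fun N : ℕ => qP (q ^ k) ((N : ℤ) + n).toNat) atTop (𝓝 (qinf (q ^ k))) :=
        (qP_tendsto hQ).comp (tendsto_atTop_mono (f := fun N => N - n.natAbs)
          (fun N => by omega) (tendsto_sub_atTop_nat _))
      have a2 : Tendsto (fun N : ℕ => qP (q ^ k) ((N : ℤ) - n).toNat) atTop (𝓝 (qinf (q ^ k))) :=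
        (qP_tendsto hQ).comp (tendsto_atTop_mono (f := fun N => N - n.natAbs)
          (fun N => by omega) (tendsto_sub_atTop_nat _))
      have hne := qinf_ne hQ
      have a3 := (a0.div (a1.mul a2) (mul_ne_zero hne hne)).const_mul
        ((-1) ^ n * q ^ ((k : ℤ) * (n * (n + 1) / 2) + n * (-(s : ℤ))))
      rw [show qinf (q ^ k) / (qinf (q ^ k) * qinf (q ^ k)) = (qinf (q ^ k))⁻¹ by field_simp] at a3
      refine a3.congr' ?_
      filter_upwards [eventually_ge_atTop n.natAbs] with N hN
      rw [if_pos (by simp; omega)]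
      rfl
    · refine Eventually.of_forall fun N n => ?_
      by_cases h : n ∈ Icc (-(N : ℤ)) N
      · rw [if_pos h, gN, norm_mul, norm_mul, div_eq_mul_inv, norm_mul, mul_inv, norm_mul, norm_zpow, norm_zpow]
        simp only [norm_neg, norm_one, one_zpow, one_mul]
        refine mul_le_mul ?_ ?_ (by positivity) (by positivity)
        · rw [← zpow_natCast]
          exact zpow_le_zpow_right_of_le_one₀ hr hq.le (th_exp k s hs1 hs n)
        · exact mul_le_mul (hC _).1 (mul_le_mul (hC _).2 (hC _).2 (norm_nonneg _) (by linarith))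
            (by positivity) (by linarith)
      · rw [if_neg h, norm_zero]; positivity
  have := tendsto_nhds_unique l hl
  rw [this, e3, tsum_mul_right, mul_assoc, inv_mul_cancel₀ (qinf_ne hQ), mul_one]
  rfl

lemma multS {q : ℂ} (hq : ‖q‖ < 1) (S : Set ℕ) :
    Multipliable ((fun j : ℕ => 1 - q ^ j) ∘ (↑) : S → ℂ) := by
  have : ((fun j : ℕ => 1 - q ^ j) ∘ (↑) : S → ℂ) = fun j : S => 1 + (- q ^ (j : ℕ)) := by
    ext; simp; ring
  rw [this]
  apply multipliable_one_add_of_summable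
  simp only [norm_neg, norm_pow]
  exact (summable_geometric_of_lt_one (norm_nonneg _) hq).comp_injective Subtype.val_injective

lemma prod_good {q : ℂ} (h0 : q ≠ 0) (hq : ‖q‖ < 1) (ν s : ℕ) (hs1 : 1 ≤ s) (hs : s ≤ 2 * ν + 2) :
    Th q (2 * ν + 3) (-(s : ℤ)) * (∏' j : {j : ℕ // 1 ≤ j ∧ (j : ZMod (2 * ν + 3)) ≠ 0 ∧
            (j : ZMod (2 * ν + 3)) ≠ (s : ZMod (2 * ν + 3)) ∧
            (j : ZMod (2 * ν + 3)) ≠ -(s : ZMod (2 * ν + 3))},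
          (1 - q ^ (j : ℕ))) = qinf q := by
  set k := 2 * ν + 3 with hk
  let S0 : Set ℕ := {j : ℕ | 1 ≤ j ∧ (j : ZMod k) ≠ 0 ∧ (j : ZMod k) ≠ (s : ZMod k) ∧
            (j : ZMod k) ≠ -(s : ZMod k)}
  let R : ℕ → Set ℕ := fun c => Set.range (fun i : ℕ => k * i + c)
  have hR : ∀ c, 1 ≤ c → c ≤ k → ∀ j, j ∈ R c ↔ 1 ≤ j ∧ j % k = c % k := by
    intro c h1 h2 j
    constructor
    · rintro ⟨i, rfl⟩
      refine ⟨by simp only; omega, by simp⟩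
    · rintro ⟨h3, h4⟩
      rcases h2.lt_or_eq with h5 | h5
      · rw [Nat.mod_eq_of_lt h5] at h4
        exact ⟨j / k, by simp only; rw [← h4]; exact Nat.div_add_mod j k⟩
      · subst h5
        rw [Nat.mod_self] at h4
        obtain ⟨d, rfl⟩ := Nat.dvd_of_mod_eq_zero h4
        rcases d with _ | d
        · omega
        · exact ⟨d, by simp only; ring⟩
  have hS0 : ∀ j, j ∈ S0 ↔ 1 ≤ j ∧ j % k ≠ k % k ∧ j % k ≠ s % k ∧ j % k ≠ (k - s) % k := by
    intro j
    have e1 : (j : ZMod k) = 0 ↔ j % k = k % k := by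
      rw [ZMod.natCast_eq_zero_iff, Nat.mod_self, Nat.dvd_iff_mod_eq_zero]
    have e2 : (j : ZMod k) = s ↔ j % k = s % k := ZMod.natCast_eq_natCast_iff' _ _ _
    have e3 : (j : ZMod k) = -(s : ZMod k) ↔ j % k = (k - s) % k := by
      rw [← ZMod.natCast_eq_natCast_iff' j (k - s) k, Nat.cast_sub (by omega)]; simp
    simp only [S0, Set.mem_ofPred_eq, ne_eq, e1, e2, e3]
  have mk : k % k = 0 := Nat.mod_self k
  have ms : s % k = s := Nat.mod_eq_of_lt (by omega)
  have mks : (k - s) % k = k - s := Nat.mod_eq_of_lt (by omega)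
  have hU : Set.range (fun i : ℕ => 1 * i + 1) = S0 ∪ (R k ∪ (R s ∪ R (k - s))) := by
    ext j
    simp only [Set.mem_union, hS0, hR k (by omega) le_rfl, hR s hs1 (by omega), hR (k - s) (by omega) (by omega)]
    constructor
    · rintro ⟨i, rfl⟩; have h1 : 1 ≤ 1 * i + 1 := by omega
      simp only [h1, true_and]; tauto
    · intro h
      have : 1 ≤ j := by tauto
      exact ⟨j - 1, by simp only; omega⟩
  have hq' : qinf q = ∏' j : Set.range (fun i : ℕ => 1 * i + 1), (1 - q ^ (j : ℕ)) := by
    rw [tprod_range (fun j : ℕ => 1 - q ^ j) (fun a b h => by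
      have h : 1 * a + 1 = 1 * b + 1 := h
      omega)]
    unfold qinf; simp
  have hRp : ∀ c, ∏' j : R c, (1 - q ^ (j : ℕ)) = ∏' i : ℕ, (1 - q ^ (k * i + c)) := by
    intro c
    exact tprod_range (fun j : ℕ => 1 - q ^ j) (fun a b h => by
      have h : k * a + c = k * b + c := h
      exact Nat.eq_of_mul_eq_mul_left (by omega) (by omega : k * a = k * b))
  rw [hq', hU]
  rw [Multipliable.tprod_union_disjoint (f := fun j : ℕ => 1 - q ^ j) ?_ (multS hq _) (multS hq _),
    Multipliable.tprod_union_disjoint (f := fun j : ℕ => 1 - q ^ j) ?_ (multS hq _) (multS hq _),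
    Multipliable.tprod_union_disjoint (f := fun j : ℕ => 1 - q ^ j) ?_ (multS hq _) (multS hq _),
    hRp, hRp, hRp]
  · have := JTP h0 hq k s hs1 (by omega)
    have e : Th q (2 * ν + 3) (-(s : ℤ)) = Th q k (-(s : ℤ)) := by rw [hk]; push_cast; rfl
    rw [e, ← this]
    have e' : (∏' j : S0, (1 - q ^ (j : ℕ))) = (∏' j : {j : ℕ // 1 ≤ j ∧ (j : ZMod k) ≠ 0 ∧
            (j : ZMod k) ≠ (s : ZMod k) ∧
            (j : ZMod k) ≠ -(s : ZMod k)},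
          (1 - q ^ (j : ℕ))) := rfl
    rw [e']; ring
  · rw [Set.disjoint_left]
    intro j
    rw [hR s hs1 (by omega), hR (k - s) (by omega) (by omega)]; omega
  · rw [Set.disjoint_left]
    intro j
    simp only [Set.mem_union, hR k (by omega) le_rfl, hR s hs1 (by omega), hR (k - s) (by omega) (by omega)]; omega
  · rw [Set.disjoint_left]
    intro j
    simp only [Set.mem_union, hS0, hR k (by omega) le_rfl, hR s hs1 (by omega), hR (k - s) (by omega) (by omega)]; omega
end AGV

namespace AGV
open Finset Filter Topology

lemma NN_step {ν : ℕ} (nn : Fin ν → ℕ) (i : Fin ν) : NN nn (i + 1) = nn i + NN nn (i + 2) := by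
  unfold NN
  have : ∀ k : Fin ν, (if (i : ℕ) + 1 ≤ (k : ℕ) + 1 then nn k else 0) =
      (if k = i then nn k else 0) + (if (i : ℕ) + 2 ≤ (k : ℕ) + 1 then nn k else 0) := by
    intro k
    by_cases h : k = i
    · subst h; simp
    · have : (k : ℕ) ≠ i := fun h' => h (Fin.ext h')
      rw [if_neg h, zero_add]
      by_cases h2 : (i : ℕ) + 1 ≤ (k : ℕ) + 1
      · rw [if_pos h2, if_pos (by omega)]
      · rw [if_neg h2, if_neg (by omega)]
  rw [Finset.sum_congr rfl fun k _ => this k, Finset.sum_add_distrib]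
  simp

def jm {ν : ℕ} (nn : Fin ν → ℕ) : Fin ν → ℕ := fun l => NN nn (ν - l)

lemma jjf_jm {ν : ℕ} (nn : Fin ν → ℕ) (l : ℕ) (h1 : 1 ≤ l) (h2 : l ≤ ν) :
    jjf (jm nn) l = (NN nn (ν + 1 - l) : ℤ) := by
  unfold jjf jm
  rw [dif_pos (by omega)]
  simp only
  congr 2; omega

lemma jm_inj {ν : ℕ} : Function.Injective (jm : (Fin ν → ℕ) → (Fin ν → ℕ)) := by
  intro a b h
  have key : ∀ i, 1 ≤ i → i ≤ ν + 1 → NN a i = NN b i := by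
    intro i h1 h2
    rcases h2.lt_or_eq with h3 | h3
    · have := congrFun h ⟨ν - i, by omega⟩
      unfold jm at this
      simp only at this
      rwa [show ν - (ν - i) = i by omega] at this
    · rw [h3, NN_top, NN_top]
  ext i
  have e1 := NN_step a i
  have e2 := NN_step b i
  rw [key _ (by omega) (by omega), key (i + 2) (by omega) (by omega)] at e1
  omega

lemma jm_range {ν : ℕ} (j : Fin ν → ℕ)
    (h : ∀ l ∈ Icc 2 ν, jjf j (l - 1) ≤ jjf j l) : ∃ nn, jm nn = j := by
  let g : ℕ → ℕ := fun i => (if i = ν + 1 then 0 else jjf j (ν + 1 - i)).toNat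
  have hg : ∀ i, 1 ≤ i → i ≤ ν → g (i + 1) ≤ g i := by
    intro i h1 h2
    simp only [g]
    rw [if_neg (by omega : i ≠ ν + 1)]
    by_cases h3 : i + 1 = ν + 1
    · rw [if_pos h3]; simp
    · rw [if_neg h3]
      have := h (ν + 1 - i) (by rw [mem_Icc]; omega)
      rw [show ν + 1 - i - 1 = ν + 1 - (i + 1) by omega] at this
      exact Int.toNat_le_toNat this
  let nn : Fin ν → ℕ := fun i => g (i + 1) - g (i + 2)
  have key : ∀ d, d ≤ ν → NN nn (ν + 1 - d) = g (ν + 1 - d) := by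
    intro d
    induction d with
    | zero => intro _; simp [NN_top, g]
    | succ d ih =>
      intro hd
      have e := NN_step nn ⟨ν - (d + 1), by omega⟩
      simp only at e
      rw [show ν - (d + 1) + 1 = ν + 1 - (d + 1) by omega,
        show ν - (d + 1) + 2 = ν + 1 - d by omega, ih (by omega)] at e
      rw [e]
      simp only [nn]
      rw [show ν - (d + 1) + 1 = ν + 1 - (d + 1) by omega,
        show ν - (d + 1) + 2 = ν + 1 - d by omega]
      have := hg (ν + 1 - (d + 1)) (by omega) (by omega)
      rw [show ν + 1 - (d + 1) + 1 = ν + 1 - d by omega] at this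
      omega
  refine ⟨nn, ?_⟩
  ext l
  have := key (l + 1) (by omega)
  unfold jm
  rw [show ν - (l : ℕ) = ν + 1 - (l + 1) by omega, this]
  simp only [g]
  rw [if_neg (by omega)]
  unfold jjf
  rw [dif_pos (by omega)]
  simp only [Int.toNat_natCast]
  congr 2; omega

lemma jjf_le {ν : ℕ} (j : Fin ν → ℕ)
    (h : ∀ l ∈ Icc 2 ν, jjf j (l - 1) ≤ jjf j l) (L : ℕ) (hL : jjf j ν ≤ L) (i : Fin ν) : j i ≤ L := by
  have key : ∀ d, d < ν → jjf j (ν - d) ≤ L := by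
    intro d
    induction d with
    | zero => intro _; simpa using hL
    | succ d ih =>
      intro hd
      have := h (ν - d) (by rw [mem_Icc]; omega)
      rw [show ν - d - 1 = ν - (d + 1) by omega] at this
      exact this.trans (ih (by omega))
  have := key (ν - (i + 1)) (by omega)
  unfold jjf at this
  rw [dif_pos (by omega)] at this
  have e : (⟨ν - (ν - (i + 1)) - 1, by omega⟩ : Fin ν) = i := by ext; simp; omega
  rw [e] at this
  exact_mod_cast this

lemma qP_inv {q : ℂ} (h0 : q ≠ 0) (n : ℕ) :
    qP q⁻¹ n = (-1) ^ n * q ^ (-((n : ℤ) * (n + 1) / 2)) * qP q n := by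
  induction n with
  | zero => simp [qP_zero]
  | succ n ih =>
    rw [qP_succ, qP_succ, ih]
    have e : (((n + 1 : ℕ) : ℤ) * ((n + 1 : ℕ) + 1) / 2) = (n : ℤ) * (n + 1) / 2 + (n + 1) := by
      push_cast
      rw [show ((n : ℤ) + 1) * (n + 1 + 1) = n * (n + 1) + 2 * (n + 1) by ring]
      omega
    rw [e, neg_add, zpow_add₀ h0]
    have e2 : q ^ (-((n : ℤ) + 1)) = (q ^ (n + 1))⁻¹ := by
      rw [zpow_neg]; norm_cast
    rw [e2, inv_pow]
    have := pow_ne_zero (n + 1) h0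
    field_simp
    ring

lemma qB_inv {q : ℂ} (h0 : q ≠ 0) (a b : ℕ) (h : b ≤ a) :
    qB q⁻¹ (a : ℤ) (b : ℤ) = q ^ (-((b : ℤ) * (a - b))) * (qP q a / (qP q b * qP q (a - b))) := by
  unfold qB
  rw [if_pos (by omega)]
  obtain ⟨c, rfl⟩ := Nat.exists_eq_add_of_le h
  have e : (((b + c : ℕ) : ℤ) - b).toNat = c := by omega
  have e' : b + c - b = c := by omega
  rw [e, e', Int.toNat_natCast, Int.toNat_natCast, qP_inv h0, qP_inv h0, qP_inv h0]
  have e2 : ((b + c : ℕ) : ℤ) * ((b + c : ℕ) + 1) / 2 = (b : ℤ) * (b + 1) / 2 + (c : ℤ) * (c + 1) / 2 + b * c := by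
    push_cast
    rw [show ((b : ℤ) + c) * (b + c + 1) = (b * (b + 1) + c * (c + 1)) + 2 * (b * c) by ring]
    have h1 : Even ((b : ℤ) * (b + 1)) := Int.even_mul_succ_self _
    obtain ⟨x, hx⟩ := h1
    have h2 : Even ((c : ℤ) * (c + 1)) := Int.even_mul_succ_self _
    obtain ⟨y, hy⟩ := h2
    rw [hx, hy]; omega
  rw [e2, neg_add, neg_add, zpow_add₀ h0, zpow_add₀ h0, pow_add]
  have n1 : ((-1 : ℂ)) ^ b ≠ 0 := pow_ne_zero _ (by norm_num)
  have n2 : ((-1 : ℂ)) ^ c ≠ 0 := pow_ne_zero _ (by norm_num)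
  have n3 := zpow_ne_zero (-((b : ℤ) * (b + 1) / 2)) h0
  have n4 := zpow_ne_zero (-((c : ℤ) * (c + 1) / 2)) h0
  rw [show ((b : ℤ) * (((b + c : ℕ) : ℤ) - b)) = b * c by push_cast; ring]
  by_cases z1 : qP q b = 0
  · simp [z1]
  by_cases z2 : qP q c = 0
  · simp [z2]
  generalize q ^ (-((b : ℤ) * (b + 1) / 2)) = X at *
  generalize q ^ (-((c : ℤ) * (c + 1) / 2)) = Y at *
  generalize q ^ (-((b : ℤ) * c)) = Z at *
  field_simp

lemma rev_sum {M : Type*} [AddCommMonoid M] (f : ℕ → M) (a b ν : ℕ) (ha : 1 ≤ a) (hb : b ≤ ν) :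
    ∑ l ∈ Icc a b, f (ν + 1 - l) = ∑ i ∈ Icc (ν + 1 - b) (ν + 1 - a), f i := by
  refine Finset.sum_nbij' (fun l => ν + 1 - l) (fun l => ν + 1 - l) ?_ ?_ ?_ ?_ ?_
  · intro l hl; simp only [mem_Icc] at *; omega
  · intro l hl; simp only [mem_Icc] at *; omega
  · intro l hl; simp only [mem_Icc] at *; omega
  · intro l hl; simp only [mem_Icc] at *; omega
  · intro l hl; rfl

lemma rev_prod (f : ℕ → ℂ) (a b ν : ℕ) (ha : 1 ≤ a) (hb : b ≤ ν) :
    ∏ l ∈ Icc a b, f (ν + 1 - l) = ∏ i ∈ Icc (ν + 1 - b) (ν + 1 - a), f i := by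
  refine Finset.prod_nbij' (fun l => ν + 1 - l) (fun l => ν + 1 - l) ?_ ?_ ?_ ?_ ?_
  · intro l hl; simp only [mem_Icc] at *; omega
  · intro l hl; simp only [mem_Icc] at *; omega
  · intro l hl; simp only [mem_Icc] at *; omega
  · intro l hl; simp only [mem_Icc] at *; omega
  · intro l hl; rfl

end AGV

namespace AGV
open Finset Filter Topology

lemma tele {q : ℂ} (hq : ‖q‖ < 1) {ν : ℕ} (nn : Fin ν → ℕ) :
    ∏ i ∈ Icc 1 (ν - 1), (qP q (NN nn i) / (qP q (NN nn (i + 1)) * qP q (NN nn i - NN nn (i + 1)))) =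
      qP q (NN nn 1) / ∏ i, qP q (nn i) := by
  have h1 : ∏ i, qP q (nn i) = ∏ i ∈ Icc 1 ν, qP q (NN nn i - NN nn (i + 1)) := by
    have := Finset.prod_bij (s := Icc 1 ν) (t := (univ : Finset (Fin ν)))
      (f := fun i => qP q (NN nn i - NN nn (i + 1))) (g := fun i => qP q (nn i))
      (fun i hi => ⟨i - 1, by rw [mem_Icc] at hi; omega⟩) (fun _ _ => mem_univ _)
      (fun a ha b hb h => by
        rw [mem_Icc] at ha hb
        have := Fin.mk.inj h
        omega)
      (fun b _ => ⟨b + 1, by rw [mem_Icc]; omega, by simp⟩)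
      (fun a ha => by
        rw [mem_Icc] at ha
        have := NN_step nn ⟨a - 1, by omega⟩
        simp only at this
        rw [show a - 1 + 1 = a by omega, show a - 1 + 2 = a + 1 by omega] at this
        rw [this]; simp)
    exact this.symm
  have h2 : ∀ m, ∏ i ∈ Icc 1 m, (qP q (NN nn i) / (qP q (NN nn (i + 1)) * qP q (NN nn i - NN nn (i + 1)))) =
      qP q (NN nn 1) / (qP q (NN nn (m + 1)) * ∏ i ∈ Icc 1 m, qP q (NN nn i - NN nn (i + 1))) := by
    intro m
    induction m with
    | zero => simp [div_self (qP_ne hq _)]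
    | succ m ih =>
      rw [Finset.prod_Icc_succ_top (by omega), Finset.prod_Icc_succ_top (by omega), ih]
      have a1 := qP_ne hq (NN nn (m + 1))
      have a2 := qP_ne hq (NN nn (m + 1 + 1))
      have a3 := qP_ne hq (NN nn (m + 1) - NN nn (m + 1 + 1))
      have a4 : ∏ i ∈ Icc 1 m, qP q (NN nn i - NN nn (i + 1)) ≠ 0 :=
        Finset.prod_ne_zero_iff.mpr fun _ _ => qP_ne hq _
      field_simp
  rw [h2, h1]
  rcases ν with _ | ν
  · simp [NN, qP_zero]
  · rw [Nat.add_sub_cancel, Finset.prod_Icc_succ_top (by omega), NN_top, Nat.sub_zero]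
    rw [mul_comm]

lemma NN_anti {ν : ℕ} (nn : Fin ν → ℕ) (i : ℕ) (h1 : 1 ≤ i) (h2 : i ≤ ν) : NN nn (i + 1) ≤ NN nn i := by
  have := NN_step nn ⟨i - 1, by omega⟩
  simp only at this
  rw [show i - 1 + 1 = i by omega, show i - 1 + 2 = i + 1 by omega] at this
  omega

lemma prod_zpow (q : ℂ) (h0 : q ≠ 0) (s : Finset ℕ) (f : ℕ → ℤ) :
    ∏ i ∈ s, q ^ f i = q ^ ∑ i ∈ s, f i := by
  induction s using Finset.induction_on with
  | empty => simp
  | insert a s ha ih => rw [Finset.prod_insert ha, Finset.sum_insert ha, zpow_add₀ h0, ih]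

def mterm (q : ℂ) (ν L : ℕ) (a : ℤ) (p : ℕ) (j : Fin ν → ℕ) : ℂ :=
    if (∑ l, (j l : ℤ)) = a then
      q ^ ((∑ l ∈ Finset.Icc 2 ν, jjf j (l - 1) * ((L : ℤ) - jjf j l)) -
            ∑ l ∈ Finset.Icc 1 p, jjf j l) *
        qB q (L : ℤ) (jjf j ν) * ∏ l ∈ Finset.Icc 2 ν, qB q (jjf j l) (jjf j (l - 1))
    else 0

lemma sum_jm {ν : ℕ} (nn : Fin ν → ℕ) : ∑ l, (jm nn l : ℤ) = SN nn := by
  have h := sum_Icc_fin (fun l => NN nn (ν + 1 - l)) ν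
  rw [rev_sum _ 1 ν ν le_rfl le_rfl] at h
  unfold SN
  rw [show ν + 1 - ν = 1 by omega, Nat.add_sub_cancel] at h
  rw [h]
  push_cast
  refine Finset.sum_congr rfl fun i _ => ?_
  simp only [jm]

lemma mterm_jm {q : ℂ} (h0 : q ≠ 0) (hq : ‖q‖ < 1) (ν L : ℕ) (hν : 1 ≤ ν) (a : ℤ) (p : ℕ) (hp : p ≤ ν)
    (nn : Fin ν → ℕ) : mterm q⁻¹ ν L a p (jm nn) =
      trm q ν (ν - p) L (fun a' => q ^ (-(L : ℤ) * a') * if a' = a then 1 else 0) nn := by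
  unfold mterm trm
  rw [sum_jm]
  by_cases ha : (SN nn : ℤ) = a
  swap
  · simp [ha]
  have e0 : jjf (jm nn) ν = NN nn 1 := by
    rw [jjf_jm nn ν hν le_rfl, show ν + 1 - ν = 1 by omega]
  rw [if_pos ha, e0]
  by_cases hL : NN nn 1 ≤ L
  swap
  · rw [if_neg hL]
    have : qB q⁻¹ (L : ℤ) (NN nn 1 : ℤ) = 0 := by
      unfold qB; rw [if_neg (by omega)]
    rw [this]; simp
  rw [if_pos hL]
  beta_reduce
  rw [if_pos ha, qB_inv h0 _ _ hL]
  have e1 : ∏ l ∈ Icc 2 ν, qB q⁻¹ (jjf (jm nn) l) (jjf (jm nn) (l - 1)) =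
      ∏ i ∈ Icc 1 (ν - 1), (q ^ (-((NN nn (i + 1) : ℤ) * (NN nn i - NN nn (i + 1)))) *
        (qP q (NN nn i) / (qP q (NN nn (i + 1)) * qP q (NN nn i - NN nn (i + 1))))) := by
    have := rev_prod (fun i => (q ^ (-((NN nn (i + 1) : ℤ) * (NN nn i - NN nn (i + 1)))) *
        (qP q (NN nn i) / (qP q (NN nn (i + 1)) * qP q (NN nn i - NN nn (i + 1)))))) 2 ν ν (by omega) le_rfl
    rw [show ν + 1 - ν = 1 by omega, show ν + 1 - 2 = ν - 1 by omega] at this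
    rw [← this]
    refine Finset.prod_congr rfl fun l hl => ?_
    rw [mem_Icc] at hl
    rw [jjf_jm nn l (by omega) (by omega), jjf_jm nn (l - 1) (by omega) (by omega),
      show ν + 1 - (l - 1) = ν + 1 - l + 1 by omega]
    exact qB_inv h0 _ _ (NN_anti nn _ (by omega) (by omega))
  have e2 : ∑ l ∈ Icc 2 ν, jjf (jm nn) (l - 1) * ((L : ℤ) - jjf (jm nn) l) =
      ∑ i ∈ Icc 1 (ν - 1), (NN nn (i + 1) : ℤ) * (L - NN nn i) := by
    have := rev_sum (fun i => (NN nn (i + 1) : ℤ) * (L - NN nn i)) 2 ν ν (by omega) le_rfl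
    rw [show ν + 1 - ν = 1 by omega, show ν + 1 - 2 = ν - 1 by omega] at this
    rw [← this]
    refine Finset.sum_congr rfl fun l hl => ?_
    rw [mem_Icc] at hl
    rw [jjf_jm nn l (by omega) (by omega), jjf_jm nn (l - 1) (by omega) (by omega),
      show ν + 1 - (l - 1) = ν + 1 - l + 1 by omega]
  have e3 : ∑ l ∈ Icc 1 p, jjf (jm nn) l = ∑ i ∈ Icc (ν - p + 1) ν, (NN nn i : ℤ) := by
    have := rev_sum (fun i => (NN nn i : ℤ)) 1 p ν le_rfl hp
    rw [show ν + 1 - p = ν - p + 1 by omega, Nat.add_sub_cancel] at this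
    rw [← this]
    refine Finset.sum_congr rfl fun l hl => ?_
    rw [mem_Icc] at hl
    rw [jjf_jm nn l (by omega) (by omega)]
  rw [e1, e2, e3, Finset.prod_mul_distrib, tele hq, prod_zpow q h0]
  have e4 : ∑ i ∈ Icc 1 ν, ((NN nn i : ℤ) * (L - NN nn i)) =
      NN nn 1 * (L - NN nn 1) + ∑ i ∈ Icc 1 (ν - 1), (NN nn (i + 1) : ℤ) * (L - NN nn (i + 1)) := by
    obtain ⟨m, rfl⟩ : ∃ m, ν = m + 1 := ⟨ν - 1, by omega⟩
    rw [sum_Icc_fin, Nat.add_sub_cancel, sum_Icc_fin, Fin.sum_univ_succ]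
    simp
  have e5 : ∑ i ∈ Icc 1 ν, ((NN nn i : ℤ) * (L - NN nn i)) =
      L * (SN nn : ℤ) - ∑ i ∈ Icc 1 ν, (NN nn i : ℤ) ^ 2 := by
    unfold SN; push_cast
    rw [Finset.mul_sum, ← Finset.sum_sub_distrib]
    exact Finset.sum_congr rfl fun i _ => by ring
  have e6 : ∑ i ∈ Icc 1 (ν - 1), (NN nn (i + 1) : ℤ) * (L - NN nn (i + 1)) =
      ∑ i ∈ Icc 1 (ν - 1), (NN nn (i + 1) : ℤ) * (L - NN nn i) +
      ∑ i ∈ Icc 1 (ν - 1), (NN nn (i + 1) : ℤ) * (NN nn i - NN nn (i + 1)) := by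
    rw [← Finset.sum_add_distrib]
    exact Finset.sum_congr rfl fun i _ => by ring
  have e7 : ((expAG ν (ν - p) nn : ℕ) : ℤ) = ∑ i ∈ Icc 1 ν, (NN nn i : ℤ) ^ 2 +
      ∑ i ∈ Icc (ν - p + 1) ν, (NN nn i : ℤ) := by
    unfold expAG; push_cast; rfl
  rw [inv_zpow', ← zpow_natCast q (expAG ν (ν - p) nn), mul_one, ← zpow_add₀ h0, Finset.sum_neg_distrib]
  have e8 : (expAG ν (ν - p) nn : ℤ) + -(L : ℤ) * SN nn =
     -(∑ i ∈ Icc 1 (ν - 1), (NN nn (i + 1) : ℤ) * (L - NN nn i) - ∑ i ∈ Icc (ν - p + 1) ν, (NN nn i : ℤ))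
      + (-((NN nn 1 : ℤ) * (L - NN nn 1)) +
      -∑ i ∈ Icc 1 (ν - 1), (NN nn (i + 1) : ℤ) * (NN nn i - NN nn (i + 1))) := by
    rw [e7]; linarith
  rw [e8, zpow_add₀ h0, zpow_add₀ h0]
  have a1 := qP_ne hq (NN nn 1)
  have a2 := qP_ne hq (L - NN nn 1)
  have a4 : ∏ i, qP q (nn i) ≠ 0 :=
        Finset.prod_ne_zero_iff.mpr fun _ _ => qP_ne hq _
  field_simp

lemma qMulti_BB {q : ℂ} (h0 : q ≠ 0) (hq : ‖q‖ < 1) (ν L : ℕ) (hν : 1 ≤ ν) (a : ℤ) (p : ℕ) (hp : p ≤ ν) :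
    qMulti ν L a p q⁻¹ = BB q ν L p (fun a' => if a' = a then 1 else 0) := by
  have hs : ∀ j, mterm q⁻¹ ν L a p j ≠ 0 → (∀ l ∈ Icc 2 ν, jjf j (l - 1) ≤ jjf j l) ∧ jjf j ν ≤ L := by
    intro j hj
    unfold mterm at hj
    split_ifs at hj
    swap
    · exact absurd rfl hj
    rw [mul_ne_zero_iff, mul_ne_zero_iff, Finset.prod_ne_zero_iff] at hj
    obtain ⟨⟨_, h1⟩, h2⟩ := hj
    constructor
    · intro l hl
      have := h2 l hl
      unfold qB at this
      by_contra hc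
      rw [if_neg (by tauto)] at this
      exact this rfl
    · unfold qB at h1
      by_contra hc
      rw [if_neg (by tauto)] at h1
      exact h1 rfl
  have hfin : (Function.support (mterm q⁻¹ ν L a p)).Finite := by
    refine (Set.finite_Icc (0 : Fin ν → ℕ) (fun _ => L)).subset ?_
    intro j hj
    have := hs j hj
    exact ⟨fun _ => Nat.zero_le _, fun i => jjf_le j this.1 L this.2 i⟩
  have e : qMulti ν L a p q⁻¹ = ∑ᶠ j, mterm q⁻¹ ν L a p j := rfl
  rw [e, ← tsum_eq_finsum (L := SummationFilter.unconditional _) hfin, BB, PP_tsum hq h0, ← jm_inj.tsum_eq (f := mterm q⁻¹ ν L a p)]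
  · exact tsum_congr fun nn => mterm_jm h0 hq ν L hν a p hp nn
  · intro j hj
    exact jm_range j (hs j hj).1

end AGV

namespace AGV
open Finset Filter Topology

lemma BB_finset {q : ℂ} (h0 : q ≠ 0) (hq : ‖q‖ < 1) (ν L p : ℕ) :
    ∃ (S : Finset (Fin ν → ℕ)) (w : (Fin ν → ℕ) → ℂ), ∀ ψ : ℤ → ℂ,
      BB q ν L p ψ = ∑ nn ∈ S, w nn * ψ (SN nn) := by
  refine ⟨(Set.finite_Icc (0 : Fin ν → ℕ) (fun _ => L)).toFinset,
    fun nn => trm q ν (ν - p) L (fun a => q ^ (-(L : ℤ) * a)) nn, fun ψ => ?_⟩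
  rw [BB, PP_tsum hq h0, tsum_eq_sum (s := (Set.finite_Icc (0 : Fin ν → ℕ) (fun _ => L)).toFinset)]
  · refine Finset.sum_congr rfl fun nn _ => ?_
    simp only [trm]
    split_ifs
    · ring
    · ring
  · intro nn h
    unfold trm
    rw [if_neg]
    intro h'
    apply h
    rw [Set.Finite.mem_toFinset]
    exact ⟨fun _ => Nat.zero_le _, fun i => (le_NN1 nn i).trans h'⟩

/-- the theta-type kernel -/
def gam (q : ℂ) (ν : ℕ) (s : ℤ) (b L : ℕ) (j a : ℤ) : ℂ :=
  (q⁻¹ ^ (j * ((2 * j + 1) * (2 * (ν : ℤ) + 3) - 2 * s)) *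
        (if a = ((ν : ℤ) * ((L : ℤ) + 1) - s - b + 1) / 2 + (2 * (ν : ℤ) + 3) * j then 1 else 0) -
      q⁻¹ ^ ((2 * j + 1) * ((2 * (ν : ℤ) + 3) * j + s)) *
        (if a = ((ν : ℤ) * ((L : ℤ) + 1) + s - b + 1) / 2 + (2 * (ν : ℤ) + 3) * j then 1 else 0))

lemma fin_lin (a c k : ℤ) (hk : 0 < k) : {j : ℤ | a = c + k * j}.Finite := by
  apply Set.Subsingleton.finite
  intro x hx y hy
  simp only [Set.mem_ofPred_eq] at hx hy
  exact mul_left_cancel₀ hk.ne' (by linarith : k * x = k * y)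

lemma gam_fin (q : ℂ) (ν : ℕ) (s : ℤ) (b L : ℕ) (a : ℤ) :
    (Function.support (fun j => gam q ν s b L j a)).Finite := by
  refine ((fin_lin a (((ν : ℤ) * ((L : ℤ) + 1) - s - b + 1) / 2) (2 * (ν : ℤ) + 3) (by positivity)).union
    (fin_lin a (((ν : ℤ) * ((L : ℤ) + 1) + s - b + 1) / 2) (2 * (ν : ℤ) + 3) (by positivity))).subset ?_
  intro j hj
  by_contra h
  simp only [Set.mem_union, Set.mem_ofPred_eq, not_or] at h
  apply hj
  simp only [gam, if_neg h.1, if_neg h.2]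
  ring

lemma W_BB {q : ℂ} (h0 : q ≠ 0) (hq : ‖q‖ < 1) (ν L : ℕ) (hν : 1 ≤ ν) (s : ℤ) (b : ℕ) (hb : b ≤ ν) :
    W ν s b L q⁻¹ = BB q ν L b (fun a => ∑ᶠ j : ℤ, gam q ν s b L j a) := by
  obtain ⟨S, w, hS⟩ := BB_finset h0 hq ν L b
  unfold W
  simp only [qMulti_BB h0 hq ν L hν _ b hb]
  have e : ∀ j : ℤ, (q⁻¹ ^ (j * ((2 * j + 1) * (2 * (ν : ℤ) + 3) - 2 * s)) *
        BB q ν L b (fun a' => if a' = (((ν : ℤ) * ((L : ℤ) + 1) - s - b + 1) / 2 + (2 * (ν : ℤ) + 3) * j) then 1 else 0) -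
      q⁻¹ ^ ((2 * j + 1) * ((2 * (ν : ℤ) + 3) * j + s)) *
        BB q ν L b (fun a' => if a' = (((ν : ℤ) * ((L : ℤ) + 1) + s - b + 1) / 2 + (2 * (ν : ℤ) + 3) * j) then 1 else 0))
      = ∑ nn ∈ S, w nn * gam q ν s b L j (SN nn) := by
    intro j
    rw [hS, hS, Finset.mul_sum, Finset.mul_sum, ← Finset.sum_sub_distrib]
    refine Finset.sum_congr rfl fun nn _ => ?_
    unfold gam
    ring
  rw [finsum_congr e, hS, finsum_sum_comm]
  · exact Finset.sum_congr rfl fun nn _ => (mul_finsum _ _).symm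
  · intro nn _
    refine (gam_fin q ν s b L (SN nn)).subset ?_
    intro j hj h
    apply hj
    simp only at h
    simp only [h, mul_zero]

lemma Th_step {q : ℂ} (h0 : q ≠ 0) (k A : ℤ) : Th q k (A + k) = -(q ^ (-A - k) * Th q k A) := by
  have h1 := Th1 q k A
  have h2 := Th2 h0 k (A + k)
  rw [show -(A + k) = -k - A by ring, h1] at h2
  rw [h2, show -A - k = -(A + k) by ring, zpow_neg]
  have := zpow_ne_zero (A + k) h0
  field_simp

lemma Th_per {q : ℂ} (h0 : q ≠ 0) (k A j : ℤ) :
    Th q k (A + 2 * k * j) = q ^ (-(2 * j * A) - k * j * (2 * j + 1)) * Th q k A := by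
  have st : ∀ A, Th q k (A + 2 * k) = q ^ (-(2 * A) - 3 * k) * Th q k A := by
    intro A
    rw [show A + 2 * k = (A + k) + k by ring, Th_step h0, Th_step h0]
    rw [show -(2 * A) - 3 * k = (-(A + k) - k) + (-A - k) by ring, zpow_add₀ h0]
    ring
  induction j using Int.induction_on with
  | zero => simp
  | succ i ih =>
    rw [show A + 2 * k * ((i : ℤ) + 1) = (A + 2 * k * i) + 2 * k by ring, st, ih, ← mul_assoc, ← zpow_add₀ h0]
    congr 2; ring
  | pred i ih =>
    have := st (A + 2 * k * (-(i : ℤ) - 1))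
    rw [show A + 2 * k * (-(i : ℤ) - 1) + 2 * k = A + 2 * k * (-(i : ℤ)) by ring, ih] at this
    have e : Th q k (A + 2 * k * (-(i : ℤ) - 1)) = q ^ (-(-(2 * (A + 2 * k * (-(i : ℤ) - 1))) - 3 * k)) *
        (q ^ (-(2 * (-(i : ℤ)) * A) - k * (-(i : ℤ)) * (2 * (-(i : ℤ)) + 1)) * Th q k A) := by
      rw [this, zpow_neg]
      rw [inv_mul_cancel_left₀ (zpow_ne_zero _ h0)]
    rw [e, ← mul_assoc, ← zpow_add₀ h0]
    congr 2; ring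

lemma Th_zero {q : ℂ} (h0 : q ≠ 0) (k j : ℤ) : Th q k (k * j) = 0 := by
  have z : Th q k 0 = 0 := by
    have := Th2 h0 k 0
    simp only [neg_zero, zpow_zero, one_mul] at this
    exact self_eq_neg.mp this
  obtain ⟨m, hm | hm⟩ := Int.even_or_odd' j
  · rw [hm, show k * (2 * m) = 0 + 2 * k * m by ring, Th_per h0, z, mul_zero]
  · rw [hm, show k * (2 * m + 1) = (0 + 2 * k * m) + k by ring, Th_step h0, Th_per h0, z]; simp

lemma gam_Th {q : ℂ} (h0 : q ≠ 0) (ν L : ℕ) (s : ℤ) (b : ℕ) (a A : ℤ)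
    (hA : A = 2 * a + b - 1 - ν * (L + 1)) (hpar : (A - s) % 2 = 0) :
    (∑ᶠ j : ℤ, gam q ν s b L j a) * Th q (2 * ν + 3) (-s) =
      ((if 2 * (2 * (ν : ℤ) + 3) ∣ A + s then 1 else 0) +
        (if 2 * (2 * (ν : ℤ) + 3) ∣ A - s then 1 else 0)) * Th q (2 * ν + 3) A := by
  set k : ℤ := 2 * (ν : ℤ) + 3 with hk
  have kp : 0 < k := by positivity
  rw [finsum_mul]
  have e : ∀ j, gam q ν s b L j a * Th q k (-s) =
      (if A = -s + (2 * k) * j then 1 else 0) * Th q k A + (if A = s + (2 * k) * j then 1 else 0) * Th q k A := by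
    intro j
    have c1 : (a = ((ν : ℤ) * ((L : ℤ) + 1) - s - b + 1) / 2 + (2 * (ν : ℤ) + 3) * j) ↔
        A = -s + (2 * k) * j := by
      rw [← hk, hA, show 2 * k * j = 2 * (k * j) by ring]
      generalize k * j = X
      generalize (ν : ℤ) * ((L : ℤ) + 1) = Y at *
      omega
    have c2 : (a = ((ν : ℤ) * ((L : ℤ) + 1) + s - b + 1) / 2 + (2 * (ν : ℤ) + 3) * j) ↔
        A = s + (2 * k) * j := by
      rw [← hk, hA, show 2 * k * j = 2 * (k * j) by ring]
      generalize k * j = X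
      generalize (ν : ℤ) * ((L : ℤ) + 1) = Y at *
      omega
    unfold gam
    simp only [c1, c2]
    rw [sub_mul, sub_eq_add_neg]
    congr 1
    · split_ifs with h
      · rw [h, Th_per h0, inv_zpow', ← hk, mul_one, one_mul]
        congr 2; ring
      · simp
    · split_ifs with h
      · rw [h, Th_per h0, Th2 h0, inv_zpow', ← hk, mul_one, one_mul, mul_neg, neg_neg, ← mul_assoc,
          ← zpow_add₀ h0]
        congr 2; ring
      · simp
  rw [finsum_congr e]
  have one : ∀ c d : ℤ, (d = A - c) → ∑ᶠ j : ℤ, ((if A = c + (2 * k) * j then (1 : ℂ) else 0) * Th q k A) =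
      (if 2 * k ∣ d then 1 else 0) * Th q k A := by
    intro c d hd
    by_cases h : 2 * k ∣ d
    · obtain ⟨j0, hj⟩ := h
      rw [finsum_eq_single _ j0]
      · rw [if_pos (by linarith), if_pos ⟨j0, hj⟩]
      · intro j hne
        rw [if_neg, zero_mul]
        intro h'
        apply hne
        exact mul_left_cancel₀ (by positivity : 2 * k ≠ 0) (by linarith)
    · rw [if_neg h]
      have : ∀ j : ℤ, ((if A = c + (2 * k) * j then (1 : ℂ) else 0) * Th q k A) = 0 := by
        intro j
        rw [if_neg, zero_mul]
        intro h'
        exact h ⟨j, by linarith⟩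
      rw [finsum_congr this]; simp
  have fs : ∀ c : ℤ, (Function.support fun j : ℤ => ((if A = c + (2 * k) * j then (1 : ℂ) else 0) * Th q k A)).Finite := by
    intro c
    refine (fin_lin A c (2 * k) (by positivity)).subset ?_
    intro j hj
    by_contra h
    simp only [Set.mem_ofPred_eq] at h
    apply hj
    simp only [if_neg h, zero_mul]
  rw [finsum_add_distrib (fs _) (fs _), one (-s) (A + s) (by ring), one s (A - s) rfl, add_mul]

lemma sum_par {q : ℂ} (h0 : q ≠ 0) (ν : ℕ) (A : ℤ) :
    ∑ s ∈ (Icc 1 (2 * ν + 2)).filter (fun s : ℕ => (A - s) % 2 = 0),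
      ((if 2 * (2 * (ν : ℤ) + 3) ∣ A + s then 1 else 0) +
        (if 2 * (2 * (ν : ℤ) + 3) ∣ A - s then 1 else 0)) * Th q (2 * ν + 3) A = Th q (2 * ν + 3) A := by
  have hr0 := Int.emod_nonneg A (by positivity : 2 * (2 * (ν : ℤ) + 3) ≠ 0)
  have hr1 := Int.emod_lt_of_pos A (by positivity : 0 < 2 * (2 * (ν : ℤ) + 3))
  have hr := Int.mul_ediv_add_emod A (2 * (2 * (ν : ℤ) + 3))
  set r := A % (2 * (2 * (ν : ℤ) + 3)) with hrd
  set m := A / (2 * (2 * (ν : ℤ) + 3)) with hm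
  have d1 : ∀ s : ℤ, 2 * (2 * (ν : ℤ) + 3) ∣ A + s ↔ 2 * (2 * (ν : ℤ) + 3) ∣ r + s := by
    intro s
    rw [← hr, add_assoc]; exact Int.dvd_add_right ⟨m, rfl⟩
  have dd : ∀ s : ℤ, -(2 * (2 * (ν : ℤ) + 3)) < s → s < 2 * (2 * (2 * (ν : ℤ) + 3)) →
      2 * (2 * (ν : ℤ) + 3) ∣ s → s = 0 ∨ s = 2 * (2 * (ν : ℤ) + 3) := by
    rintro s h1 h2 ⟨c, rfl⟩
    have hp : 0 < 2 * (2 * (ν : ℤ) + 3) := by positivity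
    have : c < 2 := by nlinarith
    have : -1 < c := by nlinarith
    have : c = 0 ∨ c = 1 := by omega
    rcases this with rfl | rfl <;> simp
  have hpar : (A - r) % 2 = 0 := by
    rw [← hr]
    rw [show 2 * (2 * (ν : ℤ) + 3) * m + r - r = 2 * ((2 * (ν : ℤ) + 3) * m) by ring]; omega
  by_cases z : r = 0 ∨ r = 2 * (ν : ℤ) + 3
  · have : Th q (2 * ν + 3) A = 0 := by
      rcases z with z | z
      · rw [← hr, z]
        convert Th_zero h0 (2 * (ν : ℤ) + 3) (2 * m) using 2; ring
      · rw [← hr, z]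
        convert Th_zero h0 (2 * (ν : ℤ) + 3) (2 * m + 1) using 2; ring
    simp [this]
  push Not at z
  rcases lt_or_ge r (2 * (ν : ℤ) + 3) with h | h
  · rw [Finset.sum_eq_single r.toNat]
    · have er : (r.toNat : ℤ) = r := Int.toNat_of_nonneg hr0
      rw [er, if_neg, if_pos]
      · simp
      · rw [sub_eq_add_neg, d1]; simp
      · rw [d1]; intro h'
        have := dd _ (by omega) (by omega) h'
        omega
    · intro t ht hne
      rw [mem_filter, mem_Icc] at ht
      rw [if_neg, if_neg]
      · simp
      · rw [sub_eq_add_neg, d1]; intro h'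
        have := dd _ (by omega) (by omega) h'
        omega
      · rw [d1]; intro h'
        have := dd _ (by omega) (by omega) h'
        omega
    · intro h'
      exfalso; apply h'
      rw [mem_filter, mem_Icc]; omega
  · rw [Finset.sum_eq_single (2 * (2 * (ν : ℤ) + 3) - r).toNat]
    · have er : ((2 * (2 * (ν : ℤ) + 3) - r).toNat : ℤ) = 2 * (2 * (ν : ℤ) + 3) - r := Int.toNat_of_nonneg (by omega)
      rw [er, if_pos, if_neg]
      · simp
      · rw [sub_eq_add_neg, d1]; intro h'
        have := dd _ (by omega) (by omega) h'
        omega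
      · rw [d1]; simp
    · intro t ht hne
      rw [mem_filter, mem_Icc] at ht
      rw [if_neg, if_neg]
      · simp
      · rw [sub_eq_add_neg, d1]; intro h'
        have := dd _ (by omega) (by omega) h'
        omega
      · rw [d1]; intro h'
        have := dd _ (by omega) (by omega) h'
        omega
    · intro h'
      exfalso; apply h'
      rw [mem_filter, mem_Icc]; omega

end AGV

theorem stmt_19 (ν : ℕ) (hν : 1 ≤ ν) (s : ℕ) (hs : s ≤ ν) (M : ℕ) (hM : 1 ≤ M)
    (q : ℂ) (hq0 : q ≠ 0) (hq : ‖q‖ < 1) :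
    ∑' nn : Fin ν → ℕ,
      q ^ ((expAG ν s nn : ℤ) - (M : ℤ) * ∑ i ∈ Finset.Icc 1 ν, (NN nn i : ℤ)) /
        ∏ i : Fin ν, qP q (nn i) =
    ∑ s' ∈ (Finset.Icc 1 (2 * ν + 2)).filter
        (fun s' => ¬ ((s : ℤ) + s') ≡ (ν : ℤ) * M [ZMOD 2]),
      W ν (s' : ℤ) (ν - s) M q⁻¹ /
        ∏' j : {j : ℕ // 1 ≤ j ∧ (j : ZMod (2 * ν + 3)) ≠ 0 ∧
            (j : ZMod (2 * ν + 3)) ≠ (s' : ZMod (2 * ν + 3)) ∧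
            (j : ZMod (2 * ν + 3)) ≠ -(s' : ZMod (2 * ν + 3))},
          (1 - q ^ (j : ℕ)) := by
  have hl : (∑' nn : Fin ν → ℕ,
      q ^ ((expAG ν s nn : ℤ) - (M : ℤ) * ∑ i ∈ Finset.Icc 1 ν, (NN nn i : ℤ)) /
        ∏ i : Fin ν, qP q (nn i)) = AGV.SS q ν s (-(M : ℤ)) := by
    unfold AGV.SS
    refine tsum_congr fun nn => ?_
    unfold AGV.sterm AGV.SN
    push_cast
    rw [neg_mul, ← sub_eq_add_neg]
  have hi := AGV.qinf_ne hq
  rw [hl]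
  apply mul_left_cancel₀ hi
  have himg : ((do
        let a ← Finset.Icc 1 (2 * ν + 2)
        pure (a : ℤ) : Finset ℤ)).filter (fun i => ¬ ((s : ℤ) + i) ≡ (ν : ℤ) * M [ZMOD 2]) =
      ((Finset.Icc 1 (2 * ν + 2)).filter
        (fun s' : ℕ => ¬ ((s : ℤ) + s') ≡ (ν : ℤ) * M [ZMOD 2])).image (fun n : ℕ => (n : ℤ)) := by
    ext x
    simp only [Finset.bind_def, Finset.pure_def, Finset.sup_eq_biUnion, Finset.mem_biUnion,
      Finset.mem_singleton, Finset.mem_filter, Finset.mem_image]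
    constructor
    · rintro ⟨⟨a, h1, rfl⟩, h2⟩
      exact ⟨a, ⟨h1, h2⟩, rfl⟩
    · rintro ⟨a, ⟨h1, h2⟩, rfl⟩
      exact ⟨⟨a, h1, rfl⟩, h2⟩
  rw [AGV.SS_Xi hq0 hq ν M s hs, Finset.mul_sum, himg,
    Finset.sum_image (fun a _ b _ h => Nat.cast_injective h)]
  obtain ⟨S, w, hS⟩ := AGV.BB_finset hq0 hq ν M (ν - s)
  have e1 : ∀ s' ∈ (Finset.Icc 1 (2 * ν + 2)).filter
        (fun s' : ℕ => ¬ ((s : ℤ) + s') ≡ (ν : ℤ) * M [ZMOD 2]),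
      AGV.qinf q * (W ν (s' : ℤ) (ν - s) M q⁻¹ /
        ∏' j : {j : ℕ // 1 ≤ j ∧ (j : ZMod (2 * ν + 3)) ≠ 0 ∧
            (j : ZMod (2 * ν + 3)) ≠ ((s' : ℤ) : ZMod (2 * ν + 3)) ∧
            (j : ZMod (2 * ν + 3)) ≠ -((s' : ℤ) : ZMod (2 * ν + 3))},
          (1 - q ^ (j : ℕ))) =
      ∑ nn ∈ S, w nn * ((∑ᶠ j : ℤ, AGV.gam q ν s' (ν - s) M j (AGV.SN nn)) *
        AGV.Th q (2 * ν + 3) (-(s' : ℤ))) := by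
    intro s' hs'
    rw [Finset.mem_filter, Finset.mem_Icc] at hs'
    have hp := AGV.prod_good hq0 hq ν s' hs'.1.1 hs'.1.2
    rw [← Int.cast_natCast (R := ZMod (2 * ν + 3)) s'] at hp
    have hne : (∏' j : {j : ℕ // 1 ≤ j ∧ (j : ZMod (2 * ν + 3)) ≠ 0 ∧
            (j : ZMod (2 * ν + 3)) ≠ ((s' : ℤ) : ZMod (2 * ν + 3)) ∧
            (j : ZMod (2 * ν + 3)) ≠ -((s' : ℤ) : ZMod (2 * ν + 3))},
          (1 - q ^ (j : ℕ))) ≠ 0 := by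
      intro h
      rw [h, mul_zero] at hp
      exact hi hp.symm
    rw [← hp, mul_assoc, mul_div_cancel₀ _ hne, AGV.W_BB hq0 hq ν M hν s' (ν - s) (by omega), hS,
      Finset.mul_sum]
    exact Finset.sum_congr rfl fun nn _ => by ring
  rw [Finset.sum_congr rfl e1, Finset.sum_comm, AGV.Xi, hS]
  refine Finset.sum_congr rfl fun nn _ => ?_
  rw [← Finset.mul_sum]
  congr 1
  set A : ℤ := 2 * (AGV.SN nn : ℤ) + ((ν - s : ℕ) : ℤ) - 1 - ν * (M + 1) with hA
  have hfil : (Finset.Icc 1 (2 * ν + 2)).filter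
        (fun s' : ℕ => ¬ ((s : ℤ) + s') ≡ (ν : ℤ) * M [ZMOD 2]) =
      (Finset.Icc 1 (2 * ν + 2)).filter (fun s' : ℕ => (A - s') % 2 = 0) := by
    refine Finset.filter_congr fun s' _ => ?_
    rw [hA, Nat.cast_sub hs, mul_add, Int.ModEq]
    generalize (ν : ℤ) * M = X
    omega
  rw [hfil, ← AGV.sum_par hq0 ν A]
  refine Finset.sum_congr rfl fun s' hs' => ?_
  rw [Finset.mem_filter] at hs'
  exact (AGV.gam_Th hq0 ν M s' (ν - s) _ A hA hs'.2).symm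

end
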